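/- Let G be a finite group having a maximal subgroup that is nilpotent and of odd order. Then G is solvable. -/

import Mathlib

open scoped commutatorElement

/-- A group has a normal `p`-complement if it has a normal subgroup of order prime to `p` and of
`p`-power index. -/
def HasNormalPComplement (p : ℕ) (G : Type*) [Group G] : Prop :=
  ∃ N : Subgroup G, N.Normal ∧ ¬ p ∣ Nat.card N ∧ ∃ n, N.index ∣ p ^ n

namespace HasNormalPComplement

variable {p : ℕ} {G H : Type*} [Group G] [Group H]

theorem of_injective [Finite G] (hG : HasNormalPComplement p G) (f : H →* G)
    (hf : Function.Injective f) : HasNormalPComplement p H := by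
  obtain ⟨N, hN, hc, n, hn⟩ := hG
  refine ⟨N.comap f, inferInstance, fun h => hc (h.trans ?_), n, ?_⟩
  · rw [Nat.card_congr ((N.comap f).equivMapOfInjective f hf).toEquiv]
    exact Subgroup.card_dvd_of_le (Subgroup.map_comap_le f N)
  · rw [Subgroup.index_comap]
    exact (Subgroup.relIndex_dvd_index_of_normal N _).trans hn

theorem of_surjective (hG : HasNormalPComplement p G) (f : G →* H)
    (hf : Function.Surjective f) : HasNormalPComplement p H := by
  obtain ⟨N, hN, hc, n, hn⟩ := hG
  exact ⟨N.map f, hN.map f hf, fun h => hc (h.trans (Subgroup.card_map_dvd N f)), n,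
    (Subgroup.index_map_dvd N hf).trans hn⟩

theorem mono [Finite G] {K L : Subgroup G} (h : K ≤ L) (hL : HasNormalPComplement p L) :
    HasNormalPComplement p K :=
  hL.of_injective (Subgroup.inclusion h) (Subgroup.inclusion_injective h)

theorem of_top (h : HasNormalPComplement p (⊤ : Subgroup G)) : HasNormalPComplement p G :=
  h.of_surjective (Subgroup.topEquiv : (⊤ : Subgroup G) ≃* G).toMonoidHom
    Subgroup.topEquiv.surjective

theorem of_not_dvd_card (h : ¬ p ∣ Nat.card G) : HasNormalPComplement p G :=
  ⟨⊤, inferInstance, by simpa using h, 0, by simp⟩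

theorem of_isPGroup [Fact p.Prime] [Finite G] (h : IsPGroup p G) : HasNormalPComplement p G := by
  obtain ⟨n, hn⟩ := IsPGroup.iff_card.mp h
  exact ⟨⊥, inferInstance, by simpa using (Fact.out : p.Prime).one_lt.ne', n, by simp [hn]⟩

/-- The normal `p`-complement consists of the elements of order prime to `p`. -/
theorem exists_mem_iff [Fact p.Prime] [Finite G] (hG : HasNormalPComplement p G) :
    ∃ N : Subgroup G, N.Characteristic ∧ (∀ x, x ∈ N ↔ ¬ p ∣ orderOf x) ∧ ¬ p ∣ Nat.card N ∧
      ∃ n, N.index ∣ p ^ n := by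
  obtain ⟨N, hN, hc, n, hn⟩ := hG
  have hmem : ∀ x, x ∈ N ↔ ¬ p ∣ orderOf x := by
    intro x
    constructor
    · intro hx h
      exact hc (h.trans (Subgroup.orderOf_dvd_natCard N hx))
    · intro hx
      have h1 : x ^ p ^ n ∈ N := by
        obtain ⟨k, hk⟩ := hn
        rw [hk, pow_mul]
        exact pow_mem (Subgroup.pow_index_mem N x) k
      have h2 : (orderOf x).Coprime (p ^ n) :=
        (((Fact.out : p.Prime).coprime_iff_not_dvd.mpr hx).pow_left n).symm
      obtain ⟨y, hy⟩ := exists_pow_eq_self_of_coprime h2.symm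
      rw [← hy]
      exact pow_mem h1 y
  refine ⟨N, ?_, hmem, hc, n, hn⟩
  rw [Subgroup.characteristic_iff_comap_eq]
  intro φ
  ext x
  rw [Subgroup.mem_comap, hmem, hmem]
  simp

/-- The normal `p`-complement of a normal subgroup is normal in the whole group. -/
theorem exists_normal [Fact p.Prime] [Finite G] {X : Subgroup G} [X.Normal]
    (hX : HasNormalPComplement p X) :
    ∃ N : Subgroup G, N.Normal ∧ N ≤ X ∧ (∀ x ∈ X, x ∈ N ↔ ¬ p ∣ orderOf x) ∧
      ¬ p ∣ Nat.card N ∧ ∃ n, N.relIndex X ∣ p ^ n := by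
  obtain ⟨N, hN, hmem, hc, n, hn⟩ := hX.exists_mem_iff
  refine ⟨N.map X.subtype, inferInstance, Subgroup.map_subtype_le N, ?_, ?_, n, ?_⟩
  · intro x hx
    have := hmem ⟨x, hx⟩
    rw [Subgroup.orderOf_mk] at this
    rw [← this]
    simp [hx]
  · rwa [Subgroup.card_map_of_injective X.subtype_injective]
  · rwa [Subgroup.relIndex, Subgroup.subgroupOf,
      Subgroup.comap_map_eq_self_of_injective X.subtype_injective]

theorem of_normal_of_index [Fact p.Prime] [Finite G] {X : Subgroup G} [X.Normal]
    (hX : HasNormalPComplement p X) {n : ℕ} (hn : X.index ∣ p ^ n) :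
    HasNormalPComplement p G := by
  obtain ⟨N, hN, hle, -, hc, m, hm⟩ := hX.exists_normal
  refine ⟨N, hN, hc, m + n, ?_⟩
  rw [← Subgroup.relIndex_mul_index hle, pow_add]
  exact mul_dvd_mul hm hn

theorem of_quotient [Fact p.Prime] [Finite G] {L : Subgroup G} [L.Normal]
    (hL : ¬ p ∣ Nat.card L) (h : HasNormalPComplement p (G ⧸ L)) : HasNormalPComplement p G := by
  obtain ⟨N, hN, hc, n, hn⟩ := h
  have hi : (N.comap (QuotientGroup.mk' L)).index = N.index :=
    Subgroup.index_comap_of_surjective N (QuotientGroup.mk'_surjective L)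
  refine ⟨N.comap (QuotientGroup.mk' L), inferInstance, ?_, n, by rwa [hi]⟩
  have h1 := Subgroup.card_mul_index (N.comap (QuotientGroup.mk' L))
  rw [hi, ← Subgroup.card_mul_index L, Subgroup.index_eq_card L, ← Subgroup.card_mul_index N,
    ← mul_assoc] at h1
  rw [Nat.eq_of_mul_eq_mul_right (Nat.pos_of_ne_zero Subgroup.index_ne_zero_of_finite) h1,
    (Fact.out : p.Prime).dvd_mul]
  tauto

theorem normalizer_of_map [Finite G] {f : H →* G} (hf : Function.Injective f) {U : Subgroup H}
    (h : HasNormalPComplement p (Subgroup.normalizer (U.map f : Set G))) :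
    HasNormalPComplement p (Subgroup.normalizer (U : Set H)) := by
  refine h.of_injective ((f.comp (Subgroup.normalizer (U : Set H)).subtype).codRestrict _
    fun x => ?_) ?_
  · exact Subgroup.le_normalizer_map (H := U) f (Subgroup.mem_map_of_mem f x.2)
  · intro x y hxy
    exact Subtype.ext (hf (congrArg Subtype.val hxy))

/-- A normal `p`-complement together with any Sylow `p`-subgroup generates the group. -/
theorem sup_sylow_eq_top [Fact p.Prime] [Finite G] {N : Subgroup G} {n : ℕ}
    (hn : N.index ∣ p ^ n) (S : Sylow p G) : N ⊔ S = ⊤ := by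
  rw [← Subgroup.index_eq_one]
  have h1 := (Subgroup.index_dvd_of_le (le_sup_left : N ≤ N ⊔ S)).trans hn
  have h2 := Subgroup.index_dvd_of_le (le_sup_right : (S : Subgroup G) ≤ N ⊔ S)
  have h3 : (p ^ n).Coprime (S : Subgroup G).index :=
    ((Fact.out : p.Prime).coprime_iff_not_dvd.mpr S.not_dvd_index).pow_left n
  exact Nat.eq_one_of_dvd_coprimes h3 h1 h2

/-- In a group with a normal `p`-complement, every element is a product of an element centralizing
the normal `p`-subgroup `D` and an element of the given Sylow `p`-subgroup. -/
theorem exists_centralizer_mul [Fact p.Prime] [Finite G] (hG : HasNormalPComplement p G)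
    {D : Subgroup G} [D.Normal] (hD : IsPGroup p D) (S : Sylow p G) (g : G) :
    ∃ k ∈ Subgroup.centralizer (D : Set G), ∃ s ∈ S, g = k * s := by
  obtain ⟨N, hN, hc, n, hn⟩ := hG
  have hg : g ∈ N ⊔ S := by rw [sup_sylow_eq_top hn S]; trivial
  rw [← SetLike.mem_coe, Subgroup.normal_mul] at hg
  obtain ⟨k, hk, s, hs, rfl⟩ := hg
  refine ⟨k, ?_, s, hs, rfl⟩
  rw [Subgroup.mem_centralizer_iff]
  intro d hd
  have hdis : Disjoint D N := by
    apply Subgroup.disjoint_of_coprime_natCard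
    obtain ⟨m, hm⟩ := IsPGroup.iff_card.mp hD
    rw [hm]
    exact ((Fact.out : p.Prime).coprime_iff_not_dvd.mpr hc).pow_left m
  exact Subgroup.commute_of_normal_of_disjoint D N inferInstance hN hdis d k hd hk

end HasNormalPComplement

/-- Normalizers grow in finite `p`-groups. -/
theorem IsPGroup.exists_mem_normalizer_of_lt {p : ℕ} [Fact p.Prime] {G : Type*} [Group G] [Finite G]
    {D P : Subgroup G} (hP : IsPGroup p P) (h : D < P) :
    D < P ⊓ Subgroup.normalizer (D : Set G) := by
  have := hP.isNilpotent
  have hlt : D.subgroupOf P < ⊤ := by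
    rw [lt_top_iff_ne_top, Ne, Subgroup.subgroupOf_eq_top]
    exact h.not_ge
  obtain ⟨x, hx, hxD⟩ := SetLike.exists_of_lt (Group.normalizerCondition_of_isNilpotent _ hlt)
  have hxN : (x : G) ∈ P ⊓ Subgroup.normalizer (D : Set G) := by
    refine Subgroup.mem_inf.mpr ⟨x.2, ?_⟩
    rw [Subgroup.mem_normalizer_iff] at hx ⊢
    intro y
    by_cases hy : y ∈ P
    · exact hx ⟨y, hy⟩
    · refine ⟨fun h' => (hy (h.le h')).elim, fun h' => (hy ?_).elim⟩
      have := P.mul_mem (P.mul_mem (P.inv_mem x.2) (h.le h')) x.2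
      simpa [mul_assoc] using this
  exact SetLike.lt_iff_le_and_exists.mpr ⟨le_inf h.le Subgroup.le_normalizer, (x : G), hxN, hxD⟩

theorem Sylow.mem_smul_iff {p : ℕ} {G : Type*} [Group G] {g x : G} {P : Sylow p G} :
    x ∈ g • P ↔ g⁻¹ * x * g ∈ P := by
  rw [← SetLike.mem_coe, Sylow.coe_smul, Set.mem_smul_set_iff_inv_smul_mem]
  simp [MulAut.smul_def, ← map_inv]

section Frobenius

variable {p : ℕ} [Fact p.Prime] {G : Type*} [Group G] [Finite G]

/-- If all normalizers of nontrivial `p`-subgroups have normal `p`-complements, then two Sylow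
`p`-subgroups are conjugate by an element centralizing their intersection. -/
theorem Sylow.exists_centralizer_smul_eq
    (hG : ∀ U : Subgroup G, IsPGroup p U → U ≠ ⊥ →
      HasNormalPComplement p (Subgroup.normalizer (U : Set G)))
    (P Q : Sylow p G) :
    ∃ c ∈ Subgroup.centralizer ((P ⊓ Q : Subgroup G) : Set G), c • P = Q := by
  induction hn : Nat.card G - Nat.card (P ⊓ Q : Subgroup G) using Nat.strong_induction_on
    generalizing P Q with
  | _ n ih =>
  subst hn
  set D : Subgroup G := P ⊓ Q with hD
  by_cases hD0 : D = ⊥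
  · obtain ⟨c, hc⟩ := MulAction.exists_smul_eq G P Q
    refine ⟨c, ?_, hc⟩
    rw [hD0, Subgroup.mem_centralizer_iff]
    simp
  by_cases hPQ : (P : Subgroup G) ≤ Q
  · exact ⟨1, one_mem _, by rw [one_smul]; exact Sylow.ext (P.3 Q.2 hPQ).symm⟩
  have hDP : D < P := lt_of_le_of_ne inf_le_left fun h => hPQ (inf_eq_left.mp h)
  have hDQ : D < Q := lt_of_le_of_ne inf_le_right fun h =>
    hPQ (Q.3 P.2 (inf_eq_right.mp h)).le
  have hDp : IsPGroup p D := P.2.to_le hDP.le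
  have hstep : ∀ {A B : Sylow p G}, D < (A ⊓ B : Subgroup G) →
      ∃ c ∈ Subgroup.centralizer (D : Set G), c • A = B := by
    intro A B h
    obtain ⟨c, hc, hcA⟩ := ih _ (Nat.sub_lt_sub_left
      ((Set.Finite.card_lt_card (Set.toFinite _) h).trans_le (Subgroup.card_le_card_group _))
      (Set.Finite.card_lt_card (Set.toFinite _) h)) A B rfl
    exact ⟨c, Subgroup.centralizer_le h.le hc, hcA⟩
  set N := Subgroup.normalizer (D : Set G) with hN
  have hsyl : ∀ A : Sylow p G, ∃ S : Sylow p N, ∀ x : N, (x : G) ∈ A → x ∈ S := by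
    intro A
    obtain ⟨S, hS⟩ := (IsPGroup.comap_subtype A.2 (K := N)).exists_le_sylow
    exact ⟨S, fun x hx => hS hx⟩
  obtain ⟨S, hS⟩ := hsyl P
  obtain ⟨T, hT⟩ := hsyl Q
  obtain ⟨n, hnST⟩ := MulAction.exists_smul_eq N S T
  obtain ⟨k, hk, s, hs, rfl⟩ := (hG D hDp hD0).exists_centralizer_mul
    (D := D.subgroupOf N) (IsPGroup.comap_subtype hDp) S n
  rw [mul_smul, Sylow.smul_eq_iff_mem_normalizer.mpr (Subgroup.le_normalizer hs)] at hnST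
  obtain ⟨R, hR⟩ := (S.2.map N.subtype).exists_le_sylow
  have hR' : ∀ x ∈ S, (x : G) ∈ R := fun x hx => hR (Subgroup.mem_map_of_mem _ hx)
  obtain ⟨c₁, hc₁, h₁⟩ := hstep (A := P) (B := R) ((P.2.exists_mem_normalizer_of_lt hDP).trans_le
    (le_inf inf_le_left fun x hx => hR' ⟨x, hx.2⟩ (hS ⟨x, hx.2⟩ hx.1)))
  obtain ⟨c₂, hc₂, h₂⟩ := hstep (A := (k : G) • R) (B := Q)
    ((Q.2.exists_mem_normalizer_of_lt hDQ).trans_le (le_inf (fun x hx => by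
      have := hT ⟨x, hx.2⟩ hx.1
      rw [← hnST, Sylow.mem_smul_iff] at this
      exact Sylow.mem_smul_iff.mpr (hR' _ this)) inf_le_left))
  refine ⟨c₂ * k * c₁, mul_mem (mul_mem hc₂ ?_) hc₁, by rw [mul_smul, mul_smul, h₁, h₂]⟩
  rw [Subgroup.mem_centralizer_iff] at hk ⊢
  intro d hd
  exact congrArg Subtype.val (hk ⟨d, Subgroup.le_normalizer hd⟩ hd)

/-- Under the assumption of Frobenius' theorem, Sylow subgroups control their own fusion. -/
theorem Sylow.exists_conj_eq_of_normalizer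
    (hG : ∀ U : Subgroup G, IsPGroup p U → U ≠ ⊥ →
      HasNormalPComplement p (Subgroup.normalizer (U : Set G)))
    (P : Sylow p G) {x g : G} (hx : x ∈ P) (hgx : g * x * g⁻¹ ∈ P) :
    ∃ y ∈ P, g * x * g⁻¹ = y * x * y⁻¹ := by
  by_cases hP : (P : Subgroup G) = ⊥
  · have : x = 1 := by rwa [← Subgroup.mem_bot, ← hP]
    exact ⟨1, one_mem _, by simp [this]⟩
  obtain ⟨c, hc, hcP⟩ := Sylow.exists_centralizer_smul_eq hG P (g⁻¹ • P)
  have hgc : g * c ∈ Subgroup.normalizer ((P : Subgroup G) : Set G) := by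
    refine Sylow.smul_eq_iff_mem_normalizer.mp ?_
    rw [mul_smul, hcP, smul_inv_smul]
  have hcx : x * c = c * x := by
    refine (Subgroup.mem_centralizer_iff.mp hc) x ⟨hx, ?_⟩
    exact Sylow.mem_smul_iff.mpr (by simpa using hgx)
  set N := Subgroup.normalizer ((P : Subgroup G) : Set G)
  have hPN : (P : Subgroup G) ≤ N := Subgroup.le_normalizer
  obtain ⟨k, hk, s, hs, hks⟩ := (hG P P.2 hP).exists_centralizer_mul
    (D := (P : Subgroup G).subgroupOf N) (IsPGroup.comap_subtype P.2) (P.subtype hPN) ⟨g * c, hgc⟩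
  have hs' : (s : G) ∈ P := hs
  have hks' : g * c = k * s := congrArg Subtype.val hks
  refine ⟨s, hs', ?_⟩
  have h1 : g * x * g⁻¹ = (g * c) * x * (g * c)⁻¹ := by
    rw [mul_assoc g c x, ← hcx]; group
  have hsx : (s : G) * x * (s : G)⁻¹ ∈ P := mul_mem (mul_mem hs' hx) (inv_mem hs')
  have h2 : (s * x * (s : G)⁻¹) * k = k * (s * x * (s : G)⁻¹) :=
    congrArg Subtype.val (Subgroup.mem_centralizer_iff.mp hk ⟨_, hPN hsx⟩ hsx)
  rw [h1, hks', mul_inv_rev]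
  calc k * s * x * ((s : G)⁻¹ * (k : G)⁻¹) = (k * (s * x * (s : G)⁻¹)) * (k : G)⁻¹ := by group
    _ = _ := by rw [← h2]; group

/-- **Frobenius' normal `p`-complement theorem**. -/
theorem HasNormalPComplement.of_normalizer
    (hG : ∀ U : Subgroup G, IsPGroup p U → U ≠ ⊥ →
      HasNormalPComplement p (Subgroup.normalizer (U : Set G))) : HasNormalPComplement p G := by
  induction hn : Nat.card G using Nat.strong_induction_on generalizing G with
  | _ n ih =>
  subst hn
  let P : Sylow p G := default
  by_cases hP : (P : Subgroup G) = ⊥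
  · refine .of_not_dvd_card fun h => P.ne_bot_of_dvd_card h hP
  have hfoc : (P : Subgroup G).focalSubgroupOf ≤ commutator P := by
    rw [← Subgroup.map_subtype_le_map_subtype, Subgroup.map_focalSubgroupOf,
      Subgroup.focalSubgroup_def, Subgroup.closure_le]
    rintro g ⟨hg, x, hx, u, rfl⟩
    rw [commutatorElement_def] at hg
    have h1 : u * x⁻¹ * u⁻¹ ∈ (P : Subgroup G) := by
      have := mul_mem (inv_mem hx) hg
      simpa [mul_assoc] using this
    obtain ⟨y, hy, hyx⟩ := P.exists_conj_eq_of_normalizer hG (inv_mem hx) h1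
    refine ⟨⁅(⟨x, hx⟩ : (P : Subgroup G)), (⟨y, hy⟩ : (P : Subgroup G))⁆,
      Subgroup.commutator_mem_commutator (Subgroup.mem_top _) (Subgroup.mem_top _), ?_⟩
    simp only [Subgroup.subtype_apply, commutatorElement_def, Subgroup.coe_mul, Subgroup.coe_inv]
    simp only [mul_assoc] at hyx ⊢
    rw [hyx]
  have hnt : Nontrivial P := (Subgroup.nontrivial_iff_ne_bot _).mpr hP
  have hnil : Group.IsNilpotent P := P.2.isNilpotent
  have hlt : (P : Subgroup G).focalSubgroupOf < ⊤ :=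
    hfoc.trans_lt (Group.IsSolvable.commutator_lt_top_of_nontrivial P)
  set K := (P : Subgroup G).transferFocal.ker with hK
  have hind : K.index = (P : Subgroup G).focalSubgroupOf.index :=
    Nat.card_congr (Subgroup.transferFocal.quotientKerMulEquivQuotientFocalSubroupOf P).toEquiv
  have hKp : ∃ n, K.index ∣ p ^ n := by
    obtain ⟨n, hn⟩ := IsPGroup.iff_card.mp P.2
    exact ⟨n, hind ▸ hn ▸ Subgroup.index_dvd_card _⟩
  have hKlt : Nat.card K < Nat.card G := by
    refine lt_of_le_of_ne (Subgroup.card_le_card_group K) fun h => hlt.ne ?_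
    rw [← Subgroup.index_eq_one, ← hind, Subgroup.index_eq_one]
    exact Subgroup.eq_top_of_card_eq K h
  obtain ⟨n, hn⟩ := hKp
  refine HasNormalPComplement.of_normal_of_index (X := K) (ih _ hKlt (fun U hU hU0 => ?_) rfl) hn
  exact .normalizer_of_map K.subtype_injective (hG _ (hU.map _)
    ((Subgroup.map_eq_bot_iff_of_injective _ K.subtype_injective).not.mpr hU0))

end Frobenius

section Quadratic

variable {R : Type*} [Ring R] {p : ℕ} [Fact p.Prime]

theorem one_add_mul_one_sub_pow {n Y : R} (hn : n * n = 0) {k : ℕ} :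
    ((1 + n) * Y * (1 - n)) ^ k = (1 + n) * Y ^ k * (1 - n) := by
  have h : (1 - n) * (1 + n) = 1 := by
    simp [sub_mul, mul_add, hn]
  induction k with
  | zero => simp [mul_sub, add_mul, hn]
  | succ k ih =>
    rw [pow_succ, ih, pow_succ]
    calc (1 + n) * Y ^ k * (1 - n) * ((1 + n) * Y * (1 - n))
        = (1 + n) * Y ^ k * ((1 - n) * (1 + n)) * Y * (1 - n) := by simp only [mul_assoc]
      _ = _ := by rw [h, mul_one]; simp only [mul_assoc]

theorem eq_zero_of_two_mul_eq_zero (hp : (p : R) = 0) (hodd : Odd p) {x : R} (h : 2 * x = 0) :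
    x = 0 := by
  obtain ⟨k, rfl⟩ := hodd
  have h1 : ((2 * k + 1 : ℕ) : R) * x = (k : R) * (2 * x) + x := by
    push_cast
    rw [add_mul, one_mul, ← mul_assoc, (Nat.cast_commute k (2 : R)).eq]
  rwa [hp, zero_mul, h, mul_zero, zero_add, eq_comm] at h1

theorem eq_zero_of_sq_eq_zero_of_pow_eq {q : ℕ} (hq : 2 ≤ q) {D : R} (h : D * D = 0)
    (hD : D ^ q = D) : D = 0 := by
  rw [← hD, ← Nat.sub_add_cancel hq, pow_add, pow_two, h, mul_zero]

/-- If `n` squares to zero and the conjugates of `Y` by `1 + n` and `1 - n` commute with `Y` and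
with each other, then `n * Y * n = 0`. -/
theorem mul_mul_eq_zero_of_commute [CharP R p] (hodd : Odd p) {f : ℕ} (hf : f ≠ 0) {n Y : R}
    (hn : n * n = 0) (hY : Y ^ p ^ f = Y) (h₁ : Commute Y ((1 + n) * Y * (1 - n)))
    (h₂ : Commute Y ((1 - n) * Y * (1 + n)))
    (h₃ : Commute ((1 + n) * Y * (1 - n)) ((1 - n) * Y * (1 + n))) : n * Y * n = 0 := by
  have hn' : -n * -n = 0 := by simp [hn]
  have hY₁ : ((1 + n) * Y * (1 - n)) ^ p ^ f = (1 + n) * Y * (1 - n) := by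
    rw [one_add_mul_one_sub_pow hn, hY]
  have hY₂ : ((1 - n) * Y * (1 + n)) ^ p ^ f = (1 - n) * Y * (1 + n) := by
    have := one_add_mul_one_sub_pow (Y := Y) hn' (k := p ^ f)
    rw [hY] at this
    simpa [sub_eq_add_neg] using this
  set Y₁ := (1 + n) * Y * (1 - n) with hY₁'
  set Y₂ := (1 - n) * Y * (1 + n) with hY₂'
  have hD : (Y - Y₁) + (Y - Y₂) = 2 * (n * Y * n) := by
    rw [hY₁', hY₂']
    noncomm_ring
  have hc : Commute (Y - Y₁) (Y - Y₂) :=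
    ((Commute.refl Y).sub_right h₂).sub_left (h₁.symm.sub_right h₃)
  have hq : 2 ≤ p ^ f := (Fact.out : p.Prime).two_le.trans (Nat.le_self_pow hf p)
  refine eq_zero_of_two_mul_eq_zero (p := p) (CharP.cast_eq_zero R p) hodd ?_
  refine eq_zero_of_sq_eq_zero_of_pow_eq hq ?_ ?_
  · calc 2 * (n * Y * n) * (2 * (n * Y * n)) = 4 * (n * Y * (n * n) * Y * n) := by noncomm_ring
      _ = 0 := by simp [hn]
  · rw [← hD, add_pow_char_pow_of_commute _ _ hc, sub_pow_char_pow_of_commute _ _ h₁,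
      sub_pow_char_pow_of_commute _ _ h₂, hY, hY₁, hY₂]

theorem commute_of_commute_conj [CharP R p] (hodd : Odd p) {m : ℕ} (hm : ¬ p ∣ m) {n Y : R}
    (hn : n * n = 0) (hY : Y ^ m = 1) (h₁ : Commute Y ((1 + n) * Y * (1 - n)))
    (h₂ : Commute Y ((1 - n) * Y * (1 + n)))
    (h₃ : Commute ((1 + n) * Y * (1 - n)) ((1 - n) * Y * (1 + n))) : Commute n Y := by
  have hn' : -n * -n = 0 := by simp [hn]
  have hm0 : 0 < m := Nat.pos_of_ne_zero fun h => hm (h ▸ dvd_zero p)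
  have hf : m.totient ≠ 0 := (Nat.totient_pos.mpr hm0).ne'
  have hpow : ∀ Z : R, Z ^ m = 1 → Z ^ p ^ m.totient = Z := by
    intro Z hZ
    have h := Nat.ModEq.pow_totient ((Fact.out : p.Prime).coprime_iff_not_dvd.mpr hm)
    rw [pow_eq_pow_mod _ hZ, h, ← pow_eq_pow_mod _ hZ, pow_one]
  have hs₁ := one_add_mul_one_sub_pow (Y := Y) hn (k := 2)
  have hs₂ : ((1 - n) * Y * (1 + n)) ^ 2 = (1 - n) * Y ^ 2 * (1 + n) := by
    simpa [sub_eq_add_neg] using one_add_mul_one_sub_pow (Y := Y) hn' (k := 2)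
  have hq : 2 ≤ p ^ m.totient := (Fact.out : p.Prime).two_le.trans (Nat.le_self_pow hf p)
  have e₁ : n * Y * n = 0 := mul_mul_eq_zero_of_commute hodd hf hn (hpow Y hY) h₁ h₂ h₃
  have e₂ : n * Y ^ 2 * n = 0 := by
    refine mul_mul_eq_zero_of_commute hodd hf hn (hpow _ ?_) ?_ ?_ ?_
    · rw [← pow_mul, mul_comm, pow_mul, hY, one_pow]
    · rw [← hs₁]; exact h₁.pow_pow 2 2
    · rw [← hs₂]; exact h₂.pow_pow 2 2
    · rw [← hs₁, ← hs₂]; exact h₃.pow_pow 2 2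
  have hY₁ : ((1 + n) * Y * (1 - n)) ^ p ^ m.totient = (1 + n) * Y * (1 - n) := by
    rw [one_add_mul_one_sub_pow hn, hpow Y hY]
  have hY₂ : ((1 - n) * Y * (1 + n)) ^ p ^ m.totient = (1 - n) * Y * (1 + n) := by
    have := one_add_mul_one_sub_pow (Y := Y) hn' (k := p ^ m.totient)
    rw [hpow Y hY] at this
    simpa [sub_eq_add_neg] using this
  have hc : 2 * (n * Y - Y * n) = (1 + n) * Y * (1 - n) - (1 - n) * Y * (1 + n) := by
    noncomm_ring
  refine sub_eq_zero.mp (eq_zero_of_two_mul_eq_zero (p := p) (CharP.cast_eq_zero R p) hodd ?_)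
  refine eq_zero_of_sq_eq_zero_of_pow_eq hq ?_ ?_
  · calc 2 * (n * Y - Y * n) * (2 * (n * Y - Y * n))
        = 4 * ((n * Y * n) * Y - n * Y ^ 2 * n - Y * (n * n) * Y + Y * (n * Y * n)) := by
          noncomm_ring
      _ = 0 := by simp [hn, e₁, e₂]
  · rw [hc, sub_pow_char_pow_of_commute _ _ h₃, hY₁, hY₂]

end Quadratic

section Replacement

open Subgroup

variable {G : Type*} [Group G]

theorem Subgroup.card_mul_relIndex_of_le {H K : Subgroup G} (h : H ≤ K) :
    Nat.card H * H.relIndex K = Nat.card K := by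
  rw [← relIndex_bot_left, ← relIndex_bot_left, relIndex_mul_relIndex _ _ _ bot_le h]

theorem Subgroup.card_mul_card_le_card_sup_mul_card_inf [Finite G] (A B : Subgroup G) :
    Nat.card A * Nat.card B ≤ Nat.card (A ⊔ B : Subgroup G) * Nat.card (A ⊓ B : Subgroup G) := by
  have h1 : B.relIndex A ≤ B.relIndex (A ⊔ B) :=
    relIndex_le_of_le_right le_sup_left
    (ne_zero_of_dvd_ne_zero Nat.card_pos.ne' (relIndex_dvd_card B _))
  have h2 := card_mul_relIndex_of_le (inf_le_left : A ⊓ B ≤ A)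
  rw [inf_comm, inf_relIndex_right] at h2
  have h3 := card_mul_relIndex_of_le (le_sup_right : B ≤ A ⊔ B)
  rw [← h2, ← h3, inf_comm]
  nlinarith [Nat.mul_le_mul_left (Nat.card (A ⊓ B : Subgroup G) * Nat.card B) h1]

theorem Subgroup.sup_le_centralizer_sup {A B : Subgroup G} (hA : A ≤ centralizer (A : Set G))
    (hB : B ≤ centralizer (B : Set G)) (hAB : B ≤ centralizer (A : Set G)) :
    A ⊔ B ≤ centralizer ((A ⊔ B : Subgroup G) : Set G) :=
  sup_le (le_centralizer_iff.mpr (sup_le hA hAB))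
    (le_centralizer_iff.mpr (sup_le (le_centralizer_iff.mpr hAB) hB))

/-- The elements `c` of `A` for which the commutator of `c` and `v` centralizes `A`. -/
def commutatorCentralizer (A : Subgroup G) (v : G) : Subgroup G where
  carrier := {c | c ∈ A ∧ c * v * c⁻¹ * v⁻¹ ∈ centralizer (A : Set G)}
  one_mem' := by simp [one_mem]
  mul_mem' := by
    rintro a b ⟨ha, ha'⟩ ⟨hb, hb'⟩
    refine ⟨mul_mem ha hb, ?_⟩
    have h := mem_centralizer_iff.mp hb' a ha
    have : a * b * v * (a * b)⁻¹ * v⁻¹ = (b * v * b⁻¹ * v⁻¹) * (a * v * a⁻¹ * v⁻¹) := by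
      calc a * b * v * (a * b)⁻¹ * v⁻¹ = (a * (b * v * b⁻¹ * v⁻¹)) * (v * a⁻¹ * v⁻¹) := by group
        _ = _ := by rw [h]; group
    rw [this]
    exact mul_mem hb' ha'
  inv_mem' := by
    rintro c ⟨hc, hc'⟩
    refine ⟨inv_mem hc, ?_⟩
    have h := mem_centralizer_iff.mp hc' c⁻¹ (inv_mem hc)
    have : c⁻¹ * v * c⁻¹⁻¹ * v⁻¹ = (c * v * c⁻¹ * v⁻¹)⁻¹ := by
      rw [eq_inv_iff_mul_eq_one]
      calc _ = c⁻¹ * v * c * v⁻¹ * (c * v * c⁻¹ * v⁻¹ * c⁻¹) * c := by group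
        _ = 1 := by rw [← h]; group
    rw [this]
    exact inv_mem hc'

theorem eq_one_of_conj_eq_sq {p : ℕ} [Fact p.Prime] {a w : G} {n : ℕ} (ha : a ^ p ^ n = 1)
    (hw : w ^ p = 1) (h : a * w * a⁻¹ = w ^ 2) : w = 1 := by
  have h1 : ∀ k : ℕ, a ^ k * w * (a ^ k)⁻¹ = w ^ 2 ^ k := by
    intro k
    induction k with
    | zero => simp
    | succ k ih =>
      calc a ^ (k + 1) * w * (a ^ (k + 1))⁻¹ = a * (a ^ k * w * (a ^ k)⁻¹) * a⁻¹ := by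
            rw [pow_succ']; group
        _ = w ^ 2 ^ (k + 1) := by rw [ih, ← conj_pow, h, ← pow_mul, pow_succ']
  have h2 := h1 (p ^ n)
  have h3 : (2 ^ p ^ n) ≡ 2 [MOD p] := by
    rw [← ZMod.natCast_eq_natCast_iff]
    push_cast
    exact ZMod.pow_card_pow 2
  rw [ha, pow_eq_pow_mod _ hw, h3, ← pow_eq_pow_mod _ hw] at h2
  simpa [pow_two] using h2

/-- A form of Thompson's replacement theorem: an abelian subgroup `A` of maximal order in `P` with
maximal intersection with `V` acts quadratically on `V`. -/
theorem commutator_mem_centralizer_of_maximal {p : ℕ} [Fact p.Prime] [Finite G]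
    {P U V A : Subgroup G} [V.Normal] (hP : IsPGroup p P) (hUV : U ≤ centralizer (V : Set G))
    (hVP : V ≤ P) (hV : V ≤ centralizer (V : Set G)) (hVp : ∀ v ∈ V, v ^ p = 1) (hAP : A ≤ P)
    (hA : A ≤ centralizer (A : Set G))
    (hmax : ∀ B ≤ P, B ≤ centralizer (B : Set G) → Nat.card B ≤ Nat.card A)
    (hmax' : ∀ B ≤ P, B ≤ centralizer (B : Set G) → Nat.card B = Nat.card A → ¬ B ≤ U →
      Nat.card (B ⊓ V : Subgroup G) ≤ Nat.card (A ⊓ V : Subgroup G))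
    {a v : G} (ha : a ∈ A) (hv : v ∈ V) : a * v * a⁻¹ * v⁻¹ ∈ centralizer (A : Set G) := by
  set B := commutatorCentralizer A v with hB
  have hBA : B ≤ A := fun _ h => h.1
  suffices h : B = A by
    rw [← h] at ha
    exact ha.2
  set C := V ⊓ centralizer (A : Set G) with hC
  set D := V ⊓ centralizer (B : Set G) with hD
  have hδV : ∀ a, a * v * a⁻¹ * v⁻¹ ∈ V := fun a =>
    mul_mem (Normal.conj_mem inferInstance v hv a) (inv_mem hv)
  have hCA : C = A ⊓ V := by
    have h1 : A ⊔ C ≤ centralizer ((A ⊔ C : Subgroup G) : Set G) :=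
      sup_le_centralizer_sup hA ((inf_le_left.trans hV).trans (centralizer_le inf_le_left))
        inf_le_right
    have h2 : A = A ⊔ C := eq_of_le_of_card_ge le_sup_left
      (hmax _ (sup_le hAP (inf_le_left.trans hVP)) h1)
    refine le_antisymm (le_inf (le_sup_right.trans h2.ge) inf_le_left) ?_
    exact le_inf inf_le_right (inf_le_left.trans hA)
  have hCD : C ≤ D := le_inf inf_le_left (inf_le_right.trans (centralizer_le hBA))
  have hδD : ∀ a ∈ A, a * v * a⁻¹ * v⁻¹ ∈ D := by
    intro a ha
    refine mem_inf.mpr ⟨hδV a, mem_centralizer_iff.mpr fun b hb => ?_⟩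
    have h1 := mem_centralizer_iff.mp hb.2 a ha
    have h2 := mem_centralizer_iff.mp (hA ha) b hb.1
    have h3 := mem_centralizer_iff.mp (hV (hδV a)) _ (hδV b)
    have h2' : b * a⁻¹ = a⁻¹ * b := by
      rw [eq_inv_mul_iff_mul_eq, ← mul_assoc, ← h2, mul_inv_cancel_right]
    calc b * (a * v * a⁻¹ * v⁻¹) = (b * a) * v * (a⁻¹ * v⁻¹) := by group
      _ = a * (b * v * b⁻¹ * v⁻¹) * v * (b * a⁻¹) * v⁻¹ := by rw [h2]; group
      _ = (b * v * b⁻¹ * v⁻¹) * (a * v * a⁻¹) * ((a * b) * a⁻¹ * v⁻¹) := by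
          rw [h1]; group
      _ = (b * v * b⁻¹ * v⁻¹) * (a * v * a⁻¹ * v⁻¹) * (v * b * v⁻¹) := by
          rw [mul_assoc a b, h2']; group
      _ = _ := by rw [h3]; group
  let f : (A ⧸ B.subgroupOf A) × C → D := fun x =>
    ⟨(x.1.out : G) * v * (x.1.out : G)⁻¹ * v⁻¹ * x.2,
      mul_mem (hδD _ x.1.out.2) (hCD x.2.2)⟩
  have hf : Function.Injective f := by
    rintro ⟨x, c⟩ ⟨y, d⟩ hxy
    have h1 : (x.out : G) * v * (x.out : G)⁻¹ * v⁻¹ * c =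
      (y.out : G) * v * (y.out : G)⁻¹ * v⁻¹ * d := congrArg Subtype.val hxy
    have h2 : y = x := by
      rw [← x.out_eq', ← y.out_eq', QuotientGroup.eq]
      refine ⟨mul_mem (inv_mem y.out.2) x.out.2, ?_⟩
      set e : G := d * (c : G)⁻¹ with he
      have heC : e ∈ C := mul_mem d.2 (inv_mem c.2)
      have h3 : (x.out : G) * v * (x.out : G)⁻¹ * v⁻¹ =
          (y.out : G) * v * (y.out : G)⁻¹ * v⁻¹ * e := by
        rw [he, ← mul_assoc, eq_mul_inv_iff_mul_eq, h1]
      have h4 : (y.out : G) * e = e * y.out := mem_centralizer_iff.mp heC.2 _ y.out.2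
      have h5 : v * e = e * v := mem_centralizer_iff.mp (hV heC.1) v hv
      have h6 : ((y.out : G)⁻¹ * x.out) * v * ((y.out : G)⁻¹ * x.out)⁻¹ * v⁻¹ = e := by
        calc _ = (y.out : G)⁻¹ * ((x.out : G) * v * (x.out : G)⁻¹ * v⁻¹) * v * y.out * v⁻¹ := by
              group
          _ = v * (y.out : G)⁻¹ * v⁻¹ * (e * v) * y.out * v⁻¹ := by rw [h3]; group
          _ = v * (y.out : G)⁻¹ * (e * y.out) * v⁻¹ := by rw [← h5]; group
          _ = v * e * v⁻¹ := by rw [← h4]; group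
          _ = e := by rw [h5, mul_inv_cancel_right]
      exact h6 ▸ heC.2
    subst h2
    simpa using h1
  have hcard : Nat.card A * Nat.card C ≤ Nat.card B * Nat.card D := by
    have h1 := Nat.card_le_card_of_injective f hf
    rw [Nat.card_prod, ← index_eq_card, ← relIndex] at h1
    rw [← card_mul_relIndex_of_le hBA, mul_assoc]
    exact Nat.mul_le_mul_left _ h1
  have hBD : B ⊔ D ≤ centralizer ((B ⊔ D : Subgroup G) : Set G) :=
    sup_le_centralizer_sup (hBA.trans (hA.trans (centralizer_le hBA)))
      ((inf_le_left.trans hV).trans (centralizer_le inf_le_left)) inf_le_right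
  have hBDP : B ⊔ D ≤ P := sup_le (hBA.trans hAP) (inf_le_left.trans hVP)
  have h1 : Nat.card (B ⊔ D : Subgroup G) ≤ Nat.card A := hmax _ hBDP hBD
  have h2 : Nat.card (B ⊓ D : Subgroup G) ≤ Nat.card C := by
    rw [hCA]
    exact card_le_of_le (inf_le_inf hBA inf_le_left)
  have h3 := card_mul_card_le_card_sup_mul_card_inf B D
  have hApos : 0 < Nat.card A := Nat.card_pos
  have hCpos : 0 < Nat.card C := Nat.card_pos
  have h4 : Nat.card (B ⊔ D : Subgroup G) = Nat.card A := by
    by_contra h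
    have := lt_of_le_of_ne h1 h
    nlinarith
  have h5 : Nat.card B * Nat.card D = Nat.card A * Nat.card C := by
    nlinarith
  by_cases hBU : B ≤ U
  · have hDV : D = V := inf_eq_left.mpr (le_centralizer_iff.mpr (hBU.trans hUV))
    have hbij : Function.Bijective f := by
      refine (Nat.bijective_iff_injective_and_card f).mpr ⟨hf, ?_⟩
      rw [Nat.card_prod, ← index_eq_card, ← relIndex]
      rw [← card_mul_relIndex_of_le hBA, mul_assoc] at h5
      exact (Nat.eq_of_mul_eq_mul_left Nat.card_pos h5).symm
    obtain ⟨⟨x, c⟩, hx⟩ := hbij.2 ⟨v, hDV ▸ hv⟩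
    have hx' : (x.out : G) * v * (x.out : G)⁻¹ * v⁻¹ * c = v := congrArg Subtype.val hx
    set b : G := ((x.out : A) : G) with hb
    have hbA : b ∈ A := x.out.2
    obtain ⟨n, hn⟩ := hP ⟨b, hAP hbA⟩
    have hbc : b * c = c * b := mem_centralizer_iff.mp c.2.2 b hbA
    have hw : v * (c : G)⁻¹ = b * v * b⁻¹ * v⁻¹ := by rw [mul_inv_eq_iff_eq_mul, hx']
    have hw1 : v * (c : G)⁻¹ = 1 := by
      refine eq_one_of_conj_eq_sq (a := b) (n := n) (congrArg Subtype.val hn)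
        (hVp _ (mul_mem hv (inv_mem c.2.1))) ?_
      have hbc' : (c : G)⁻¹ * b⁻¹ = b⁻¹ * (c : G)⁻¹ := by rw [← mul_inv_rev, hbc, mul_inv_rev]
      calc b * (v * (c : G)⁻¹) * b⁻¹ = b * v * ((c : G)⁻¹ * b⁻¹) := by group
        _ = (b * v * b⁻¹ * v⁻¹) * (v * (c : G)⁻¹) := by rw [hbc']; group
        _ = _ := by rw [← hw, pow_two]
    have hvC : v ∈ centralizer (A : Set G) := by
      rw [mul_inv_eq_one.mp hw1]
      exact c.2.2
    refine le_antisymm hBA fun a ha => ⟨ha, ?_⟩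
    rw [mem_centralizer_iff.mp hvC a ha]
    simp [one_mem]
  · have h6 := hmax' _ hBDP hBD h4 fun h => hBU (le_sup_left.trans h)
    rw [← hCA] at h6
    have h7 : Nat.card D ≤ Nat.card C :=
      (card_le_of_le (le_inf le_sup_right inf_le_left)).trans h6
    refine eq_of_le_of_card_ge hBA ?_
    nlinarith

end Replacement

section QuadraticAction

open Subgroup

universe u

variable {G : Type u} [Group G]

/-- The conjugation action on an abelian normal subgroup, as a representation. -/
theorem exists_conj_representation (V : Subgroup G) [V.Normal] (hV : V ≤ centralizer (V : Set G))
    {p : ℕ} (hVp : ∀ v ∈ V, v ^ p = 1) :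
    ∃ (M : Type u) (_ : AddCommGroup M) (ρ : G →* AddMonoid.End M) (e : V → M),
      Function.Bijective e ∧ (∀ v w, e (v * w) = e v + e w) ∧ (∀ x : M, p • x = 0) ∧
      ∀ g v, ρ g (e v) = e (MulAut.conjNormal g v) := by
  let _ : CommGroup V :=
    { (inferInstance : Group V) with
      mul_comm := fun x y => Subtype.ext (mem_centralizer_iff.mp (hV y.2) x x.2) }
  refine ⟨Additive V, inferInstance,
    { toFun := fun g => MonoidHom.toAdditive ((MulAut.conjNormal g : MulAut V) : V →* V)
      map_one' := ?_
      map_mul' := ?_ }, Additive.ofMul, Additive.ofMul.bijective, fun _ _ => rfl, ?_,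
      fun _ _ => rfl⟩
  · rw [map_one]
    rfl
  · intro g h
    rw [map_mul]
    rfl
  · intro x
    exact congrArg Additive.ofMul (Subtype.ext (hVp _ (Additive.toMul x).2))

theorem charP_addMonoidEnd {M : Type*} [AddCommGroup M] [Nontrivial M] {p : ℕ} [hp : Fact p.Prime]
    (h : ∀ x : M, p • x = 0) : CharP (AddMonoid.End M) p := by
  have h0 : (p : AddMonoid.End M) = 0 := by
    ext x
    simpa using h x
  have hnt : Nontrivial (AddMonoid.End M) := by
    obtain ⟨x, hx⟩ := exists_ne (0 : M)
    exact ⟨1, 0, fun h => hx (DFunLike.congr_fun h x)⟩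
  obtain ⟨c, hc⟩ := CharP.exists (AddMonoid.End M)
  rcases (Nat.dvd_prime hp.out).mp ((CharP.cast_eq_zero_iff _ c p).mp h0) with rfl | rfl
  · exact absurd rfl (CharP.char_ne_one (AddMonoid.End M) 1)
  · exact hc

/-- An element acting quadratically on an elementary abelian normal `p`-subgroup `V`, with `p` odd,
commutes modulo the centralizer of `V` with any `p'`-element that commutes with its conjugates. -/
theorem commutator_mem_centralizer_of_quadratic {p : ℕ} [Fact p.Prime] (hodd : Odd p)
    {V : Subgroup G} [V.Normal] (hV : V ≤ centralizer (V : Set G)) (hVp : ∀ v ∈ V, v ^ p = 1)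
    {a y : G} {m : ℕ} (hm : ¬ p ∣ m)
    (ha : ∀ v ∈ V, a * (a * v * a⁻¹ * v⁻¹) * a⁻¹ = a * v * a⁻¹ * v⁻¹)
    (hy : y ^ m ∈ centralizer (V : Set G))
    (h₁ : ⁅y, a * y * a⁻¹⁆ ∈ centralizer (V : Set G))
    (h₂ : ⁅y, a⁻¹ * y * a⁆ ∈ centralizer (V : Set G))
    (h₃ : ⁅a * y * a⁻¹, a⁻¹ * y * a⁆ ∈ centralizer (V : Set G)) :
    ⁅a, y⁆ ∈ centralizer (V : Set G) := by
  obtain ⟨M, _, ρ, e, he, hadd, hp, hρ⟩ := exists_conj_representation V hV hVp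
  have hker : ∀ g, ρ g = 1 ↔ g ∈ centralizer (V : Set G) := by
    intro g
    rw [mem_centralizer_iff]
    constructor
    · intro h v hv
      have h1 := hρ g ⟨v, hv⟩
      rw [h] at h1
      have h2 := congrArg Subtype.val (he.1 h1)
      simp only [MulAut.conjNormal_apply] at h2
      exact eq_mul_inv_iff_mul_eq.mp h2
    · intro h
      ext x
      obtain ⟨v, rfl⟩ := he.2 x
      rw [hρ]
      refine congrArg e (Subtype.ext ?_)
      simp only [MulAut.conjNormal_apply]
      exact mul_inv_eq_iff_eq_mul.mpr (h v v.2).symm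
  have hcomm : ∀ g h, Commute (ρ g) (ρ h) ↔ ⁅g, h⁆ ∈ centralizer (V : Set G) := by
    intro g h
    rw [← hker, commutatorElement_def]
    have hh : (ρ g⁻¹ * ρ h⁻¹) * (ρ h * ρ g) = 1 := by
      simp only [← map_mul]; simp
    have hh' : (ρ h * ρ g) * (ρ g⁻¹ * ρ h⁻¹) = 1 := by
      simp only [← map_mul]; simp
    constructor
    · intro hc
      rw [map_mul, map_mul, map_mul, hc.eq, mul_assoc (ρ h * ρ g), hh']
    · intro hc
      rw [map_mul, map_mul, map_mul, mul_assoc (ρ g * ρ h)] at hc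
      calc ρ g * ρ h = ρ g * ρ h * ((ρ g⁻¹ * ρ h⁻¹) * (ρ h * ρ g)) := by rw [hh, mul_one]
        _ = _ := by rw [← mul_assoc, hc, one_mul]
  rw [← hcomm]
  rcases subsingleton_or_nontrivial M with hM | hM
  · ext x
    exact Subsingleton.elim _ _
  have := charP_addMonoidEnd hp
  set n := ρ a - 1 with hn
  have hn2 : n * n = 0 := by
    have key : ∀ v, n (e v) = e (MulAut.conjNormal a v * v⁻¹) := by
      intro v
      have : e v⁻¹ = - e v := by
        rw [eq_neg_iff_add_eq_zero, ← hadd, inv_mul_cancel]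
        have := hadd 1 1
        simpa using this
      rw [hadd, this, ← hρ, ← sub_eq_add_neg]
      rfl
    ext x
    obtain ⟨v, rfl⟩ := he.2 x
    have h1 : e 1 = 0 := by simpa using hadd 1 1
    change n (n (e v)) = 0
    rw [key, key, ← h1]
    refine congrArg e (Subtype.ext ?_)
    simp only [coe_mul, coe_inv, MulAut.conjNormal_apply, coe_one]
    rw [ha v v.2, mul_inv_cancel]
  have ha1 : ρ a = 1 + n := by rw [hn]; abel
  have ha2 : ρ a⁻¹ = 1 - n := by
    have h1 : ρ a * (1 - n) = 1 := by
      rw [ha1]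
      simp [add_mul, mul_sub, hn2]
    have h2 : ρ a⁻¹ * ρ a = 1 := by rw [← map_mul, inv_mul_cancel, map_one]
    calc ρ a⁻¹ = ρ a⁻¹ * (ρ a * (1 - n)) := by rw [h1, mul_one]
      _ = 1 - n := by rw [← mul_assoc, h2, one_mul]
  rw [← hcomm] at h₁ h₂ h₃
  simp only [map_mul, ha1, ha2] at h₁ h₂ h₃
  have hfin := commute_of_commute_conj hodd hm hn2
    (by rw [← map_pow]; exact (hker _).mpr hy) h₁ h₂ h₃
  rw [ha1]
  exact (Commute.one_left _).add_left hfin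

end QuadraticAction

section CharacteristicSubgroups

open Subgroup

/-- The elements of order dividing `p` of the center. -/
def omegaCenter (p : ℕ) (H : Type*) [Group H] : Subgroup H where
  carrier := {x | x ∈ center H ∧ x ^ p = 1}
  one_mem' := by simp [one_mem]
  mul_mem' := by
    rintro x y ⟨hx, hx'⟩ ⟨hy, hy'⟩
    refine ⟨mul_mem hx hy, ?_⟩
    rw [Commute.mul_pow ((mem_center_iff.mp hy) x), hx', hy', mul_one]
  inv_mem' := by
    rintro x ⟨hx, hx'⟩
    exact ⟨inv_mem hx, by rw [inv_pow, hx', inv_one]⟩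

instance (p : ℕ) (H : Type*) [Group H] : (omegaCenter p H).Characteristic := by
  rw [characteristic_iff_le_comap]
  rintro φ x ⟨hx, hx'⟩
  refine ⟨?_, ?_⟩
  · have : φ x ∈ (center H).map φ.toMonoidHom := mem_map_of_mem _ hx
    rwa [characteristic_iff_map_eq.mp inferInstance φ] at this
  · change (φ x) ^ p = 1
    rw [← map_pow, hx', map_one]

theorem IsPGroup.omegaCenter_ne_bot {p : ℕ} [hp : Fact p.Prime] {H : Type*} [Group H] [Finite H]
    [Nontrivial H] (hH : IsPGroup p H) : omegaCenter p H ≠ ⊥ := by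
  have hc := hH.center_nontrivial
  obtain ⟨n, hn0, hn⟩ := (hH.to_subgroup (center H)).nontrivial_iff_card.mp hc
  obtain ⟨x, hx⟩ := exists_prime_orderOf_dvd_card' p (hn ▸ dvd_pow_self p hn0.ne')
  intro h
  have h1 : (x : H) ∈ omegaCenter p H :=
    ⟨x.2, by rw [← coe_pow, ← hx, pow_orderOf_eq_one, coe_one]⟩
  rw [h, mem_bot] at h1
  rw [show x = 1 from Subtype.ext h1, orderOf_one] at hx
  exact hp.out.one_lt.ne hx

/-- The abelian subgroups of maximal order of a subgroup `P`. -/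
def maxAbelian {G : Type*} [Group G] (P : Subgroup G) : Set (Subgroup G) :=
  {A | A ≤ P ∧ A ≤ centralizer (A : Set G) ∧
    ∀ B ≤ P, B ≤ centralizer (B : Set G) → Nat.card B ≤ Nat.card A}

variable {G : Type*} [Group G]

theorem Subgroup.map_le_centralizer_map {K : Type*} [Group K] (f : G →* K) {A : Subgroup G}
    (hA : A ≤ centralizer (A : Set G)) :
    A.map f ≤ centralizer ((A.map f : Subgroup K) : Set K) := by
  rintro _ ⟨a, ha, rfl⟩
  rw [mem_centralizer_iff]
  rintro _ ⟨b, hb, rfl⟩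
  rw [← map_mul, ← map_mul, mem_centralizer_iff.mp (hA ha) b hb]

theorem Subgroup.card_map_eq {K : Type*} [Group K] {f : G →* K} (hf : Function.Injective f)
    (A : Subgroup G) : Nat.card (A.map f) = Nat.card A :=
  (Nat.card_congr (A.equivMapOfInjective f hf).toEquiv).symm

/-- The Thompson subgroup, generated by the abelian subgroups of maximal order of `P`. -/
def thompsonSubgroup (P : Subgroup G) : Subgroup G := sSup (maxAbelian P)

theorem thompsonSubgroup_le (P : Subgroup G) : thompsonSubgroup P ≤ P :=
  sSup_le fun _ h => h.1

theorem maxAbelian_nonempty [Finite G] (P : Subgroup G) : (maxAbelian P).Nonempty := by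
  obtain ⟨A, hA, hmax⟩ := Set.exists_max_image {A : Subgroup G | A ≤ P ∧ A ≤ centralizer (A : Set G)}
    (fun A => Nat.card A) (Set.toFinite _) ⟨⊥, bot_le, bot_le⟩
  exact ⟨A, hA.1, hA.2, fun B hB hB' => hmax B ⟨hB, hB'⟩⟩

theorem thompsonSubgroup_ne_bot [Finite G] {P : Subgroup G} (hP : P ≠ ⊥) :
    thompsonSubgroup P ≠ ⊥ := by
  intro h
  obtain ⟨A, hA⟩ := maxAbelian_nonempty P
  obtain ⟨x, hx1⟩ := ne_bot_iff_exists_ne_one.mp hP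
  have hA0 : A = ⊥ := le_bot_iff.mp (h ▸ le_sSup hA)
  have h1 := hA.2.2 (zpowers (x : G)) (zpowers_le.mpr x.2) (le_centralizer _)
  rw [hA0, card_bot, Nat.card_zpowers] at h1
  have h2 := orderOf_pos (x : G)
  exact hx1 (Subtype.ext (orderOf_eq_one_iff.mp (by omega)))

instance (P : Subgroup G) [Finite G] : ((thompsonSubgroup P).subgroupOf P).Characteristic := by
  rw [characteristic_iff_le_comap]
  intro φ
  suffices h : thompsonSubgroup P ≤
      (((thompsonSubgroup P).subgroupOf P).comap φ.toMonoidHom).map P.subtype by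
    intro x hx
    obtain ⟨y, hy, hyx⟩ := h hx
    rwa [Subtype.ext hyx] at hy
  refine sSup_le fun A hA a ha => ⟨⟨a, hA.1 ha⟩, ?_, rfl⟩
  set f : P →* G := P.subtype.comp φ.toMonoidHom with hf
  have hfi : Function.Injective f := P.subtype_injective.comp φ.injective
  have hA' : (A.subgroupOf P).map f ∈ maxAbelian P := by
    refine ⟨?_, ?_, ?_⟩
    · rw [hf, ← map_map]
      exact map_subtype_le _
    · refine map_le_centralizer_map f fun x hx => ?_
      rw [mem_centralizer_iff]
      intro y hy
      exact Subtype.ext (mem_centralizer_iff.mp (hA.2.1 hx) y hy)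
    · rw [card_map_eq hfi, Nat.card_congr (subgroupOfEquivOfLe hA.1).toEquiv]
      exact hA.2.2
  exact le_sSup hA' (mem_map_of_mem f (x := ⟨a, hA.1 ha⟩) ha)

theorem thompsonSubgroup_normal {P U : Subgroup G} [U.Normal] (hUP : U ≤ P)
    (h : ∀ A ∈ maxAbelian P, A ≤ U) : (thompsonSubgroup P).Normal := by
  have key : ∀ g : G, thompsonSubgroup P ≤
      (thompsonSubgroup P).comap (MulAut.conj g).toMonoidHom := by
    intro g
    refine sSup_le fun A hA => ?_
    rw [← map_le_iff_le_comap]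
    refine le_sSup ⟨?_, map_le_centralizer_map _ hA.2.1, ?_⟩
    · rintro _ ⟨a, ha, rfl⟩
      exact hUP (Normal.conj_mem inferInstance a (h A hA ha) g)
    · rw [card_map_eq (MulAut.conj g).injective]
      exact hA.2.2
  exact ⟨fun n hn g => key g hn⟩

end CharacteristicSubgroups

section Configuration

open Subgroup

variable {G : Type*} [Group G]

theorem commutator_kernel_normal {P U E : Subgroup G} [U.Normal] [E.Normal] (hUP : U ≤ P)
    (hPE : P ⊔ E = ⊤) :
    (P ⊓ (centralizer ((E.map (QuotientGroup.mk' U) : Subgroup (G ⧸ U)) : Set (G ⧸ U))).comap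
      (QuotientGroup.mk' U)).Normal := by
  have hE : (E.map (QuotientGroup.mk' U)).Normal :=
    Normal.map inferInstance _ (QuotientGroup.mk'_surjective U)
  set C := (centralizer ((E.map (QuotientGroup.mk' U) : Subgroup (G ⧸ U)) : Set (G ⧸ U))).comap
      (QuotientGroup.mk' U) with hC
  have hUC : U ≤ C := by
    intro u hu
    rw [hC, mem_comap, QuotientGroup.mk'_apply, (QuotientGroup.eq_one_iff u).mpr hu]
    exact one_mem _
  refine ⟨fun n hn g => mem_inf.mpr ⟨?_, Normal.conj_mem inferInstance n hn.2 g⟩⟩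
  have hg : g ∈ P ⊔ E := by rw [hPE]; trivial
  rw [← SetLike.mem_coe, mul_normal] at hg
  obtain ⟨x, hx, e, he, rfl⟩ := hg
  have h1 : n⁻¹ * (e * n * e⁻¹) ∈ U := by
    rw [← QuotientGroup.eq]
    have h2 := mem_centralizer_iff.mp (mem_comap.mp hn.2) (e : G ⧸ U) (mem_map_of_mem _ he)
    simp only [QuotientGroup.mk'_apply] at h2
    simp only [QuotientGroup.mk_mul, QuotientGroup.mk_inv]
    rw [h2, mul_inv_cancel_right]
  have h3 : e * n * e⁻¹ ∈ P := by
    have := mul_mem hn.1 (hUP h1)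
    rwa [mul_inv_cancel_left] at this
  have h4 : x * e * n * (x * e)⁻¹ = x * (e * n * e⁻¹) * x⁻¹ := by group
  rw [h4]
  exact mul_mem (mul_mem hx h3) (inv_mem hx)

theorem false_of_configuration {p : ℕ} [Fact p.Prime] (hodd : Odd p) [Finite G] (P : Sylow p G)
    {U E : Subgroup G} [U.Normal] [E.Normal]
    (hU : ∀ W : Subgroup G, W.Normal → IsPGroup p W → W ≤ U) (hUp : IsPGroup p U)
    (hCU : centralizer (U : Set G) ≤ U)
    (hchar : ∀ C : Subgroup P, C.Characteristic → C ≠ ⊥ →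
      IsPGroup p (normalizer (C.map (P : Subgroup G).subtype : Set G)))
    (hG : ¬ IsPGroup p G) (hE : ∀ x ∈ E, ∀ y ∈ E, ⁅x, y⁆ ∈ U)
    (hEp : ∀ x ∈ E, ∃ m, ¬ p ∣ m ∧ x ^ m ∈ U) (hPE : (P : Subgroup G) ⊔ E = ⊤) : False := by
  have hUP : U ≤ P := hUp.le_sylow_of_normal P
  have hU0 : U ≠ ⊥ := by
    rintro rfl
    have h1 : (⊤ : Subgroup G) ≤ ⊥ := by
      intro x _
      exact hCU (mem_centralizer_iff.mpr fun y hy => by rw [mem_bot.mp hy, one_mul, mul_one])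
    exact hG fun x => ⟨0, by simpa using h1 (mem_top x)⟩
  have hP0 : (P : Subgroup G) ≠ ⊥ := fun h => hU0 (le_bot_iff.mp (h ▸ hUP))
  have : Nontrivial P := (nontrivial_iff_ne_bot _).mpr hP0
  set V := (omegaCenter p U).map U.subtype with hVdef
  have hVU : V ≤ U := map_subtype_le _
  have hUV : U ≤ centralizer (V : Set G) := by
    intro u hu
    rw [mem_centralizer_iff]
    rintro _ ⟨x, hx, rfl⟩
    exact congrArg Subtype.val (mem_center_iff.mp hx.1 ⟨u, hu⟩).symm
  have hVp : ∀ v ∈ V, v ^ p = 1 := by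
    rintro _ ⟨x, hx, rfl⟩
    exact congrArg Subtype.val hx.2
  have hZV : (omegaCenter p P).map (P : Subgroup G).subtype ≤ V := by
    rintro _ ⟨x, hx, rfl⟩
    have h1 : ∀ u ∈ U, u * x = x * u := fun u hu =>
      congrArg Subtype.val (mem_center_iff.mp hx.1 ⟨u, hUP hu⟩)
    have hxU : (x : G) ∈ U := hCU (mem_centralizer_iff.mpr h1)
    exact ⟨⟨x, hxU⟩, ⟨mem_center_iff.mpr fun u => Subtype.ext (h1 u u.2),
      Subtype.ext (congrArg (Subtype.val : P → G) hx.2)⟩, rfl⟩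
  have hCV : centralizer (V : Set G) ≤ U := by
    refine hU _ inferInstance ?_
    exact (hchar _ inferInstance P.2.omegaCenter_ne_bot).to_le
      ((centralizer_le hZV).trans (centralizer_le_normalizer _))
  obtain ⟨A₀, hA₀, hA₀U⟩ : ∃ A ∈ maxAbelian (P : Subgroup G), ¬ A ≤ U := by
    by_contra! h
    have hJ := thompsonSubgroup_normal hUP h
    have hJ' := hchar ((thompsonSubgroup (P : Subgroup G)).subgroupOf P) inferInstance (by
      rw [Ne, subgroupOf_eq_bot, disjoint_iff, inf_eq_left.mpr (thompsonSubgroup_le _)]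
      exact thompsonSubgroup_ne_bot hP0)
    rw [map_subgroupOf_eq_of_le (thompsonSubgroup_le _), normalizer_eq_top] at hJ'
    exact hG (hJ'.of_equiv topEquiv)
  obtain ⟨A, ⟨hA, hAU⟩, hmax⟩ := Set.exists_max_image
    {A | A ∈ maxAbelian (P : Subgroup G) ∧ ¬ A ≤ U} (fun A => Nat.card (A ⊓ V : Subgroup G))
    (Set.toFinite _) ⟨A₀, hA₀, hA₀U⟩
  obtain ⟨a, haA, haU⟩ := SetLike.not_le_iff_exists.mp hAU
  have hquad : ∀ v ∈ V, a * (a * v * a⁻¹ * v⁻¹) * a⁻¹ = a * v * a⁻¹ * v⁻¹ := by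
    intro v hv
    have := commutator_mem_centralizer_of_maximal P.2 hUV (hVU.trans hUP) (hVU.trans hUV) hVp hA.1
      hA.2.1 hA.2.2 (fun B hB hB' hc hBU => hmax B
        ⟨⟨hB, hB', fun C hC hC' => hc ▸ hA.2.2 C hC hC'⟩, hBU⟩) haA hv
    rw [mul_inv_eq_iff_eq_mul]
    exact mem_centralizer_iff.mp this a haA
  have haE : ∀ y ∈ E, ⁅a, y⁆ ∈ U := by
    intro y hy
    obtain ⟨m, hm, hym⟩ := hEp y hy
    have h1 : a * y * a⁻¹ ∈ E := Normal.conj_mem inferInstance y hy a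
    have h2 : a⁻¹ * y * a ∈ E := by simpa using Normal.conj_mem (H := E) inferInstance y hy a⁻¹
    exact hCV (commutator_mem_centralizer_of_quadratic hodd (hVU.trans hUV) hVp hm hquad
      (hUV hym) (hUV (hE _ hy _ h1)) (hUV (hE _ hy _ h2)) (hUV (hE _ h1 _ h2)))
  refine haU (hU _ (commutator_kernel_normal hUP hPE) (P.2.to_le inf_le_left)
    ⟨hA.1 haA, mem_comap.mpr (mem_centralizer_iff.mpr ?_)⟩)
  rintro _ ⟨y, hy, rfl⟩
  have h1 := (QuotientGroup.eq_one_iff (N := U) _).mpr (haE y hy)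
  rw [← QuotientGroup.mk'_apply, map_commutatorElement, commutatorElement_eq_one_iff_mul_comm] at h1
  exact h1.symm

end Configuration

section CharIn

open Subgroup

variable {G : Type*} [Group G]

/-- `D` is a characteristic subgroup of the subgroup `P`. -/
def IsCharIn (D P : Subgroup G) : Prop :=
  D ≤ P ∧ ∀ φ : P ≃* P, ∀ x : P, (x : G) ∈ D → (φ x : G) ∈ D

theorem IsCharIn.map_subtype {P : Subgroup G} (C : Subgroup P) [hC : C.Characteristic] :
    IsCharIn (C.map P.subtype) P := by
  refine ⟨map_subtype_le _, ?_⟩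
  rintro φ x ⟨y, hy, hyx⟩
  obtain rfl : y = x := Subtype.ext hyx
  exact mem_map_of_mem _ (characteristic_iff_le_comap.mp hC φ hy)

theorem IsCharIn.normalizer_le {D P : Subgroup G} (h : IsCharIn D P) :
    normalizer (P : Set G) ≤ normalizer (D : Set G) := by
  have key : ∀ g ∈ normalizer (P : Set G), ∀ x ∈ D, g * x * g⁻¹ ∈ D := by
    intro g hg x hx
    exact h.2 (MulDistribMulAction.toMulEquiv P (⟨g, hg⟩ : normalizer (P : Set G))) ⟨x, h.1 hx⟩ hx
  intro g hg
  rw [mem_normalizer_iff]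
  refine fun x => ⟨key g hg x, fun hx => ?_⟩
  have := key g⁻¹ (inv_mem hg) _ hx
  simpa [mul_assoc] using this

theorem IsCharIn.map {K : Type*} [Group K] {f : G →* K} {D P : Subgroup G} (h : IsCharIn D P)
    (hf : Set.InjOn f P) : IsCharIn (D.map f) (P.map f) := by
  refine ⟨Subgroup.map_mono h.1, ?_⟩
  have hb : Function.Bijective (f.subgroupMap P) :=
    ⟨fun x y hxy => Subtype.ext (hf x.2 y.2 (congrArg Subtype.val hxy)),
      f.subgroupMap_surjective P⟩
  set e : P ≃* P.map f := MulEquiv.ofBijective _ hb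
  rintro φ ⟨_, hx'⟩ ⟨x, hx, rfl⟩
  have h1 := h.2 ((e.trans φ).trans e.symm) ⟨x, h.1 hx⟩ hx
  refine ⟨_, h1, ?_⟩
  exact congrArg Subtype.val (e.apply_symm_apply (φ (e ⟨x, h.1 hx⟩)))

theorem IsCharIn.comap_inf {K : Type*} [Group K] {f : G →* K} {P : Subgroup G} {D : Subgroup K}
    (h : IsCharIn D (P.map f)) (hf : Set.InjOn f P) : IsCharIn (D.comap f ⊓ P) P := by
  refine ⟨inf_le_right, ?_⟩
  have hb : Function.Bijective (f.subgroupMap P) :=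
    ⟨fun x y hxy => Subtype.ext (hf x.2 y.2 (congrArg Subtype.val hxy)),
      f.subgroupMap_surjective P⟩
  set e : P ≃* P.map f := MulEquiv.ofBijective _ hb
  rintro φ x hx
  have h1 := h.2 ((e.symm.trans φ).trans e) (e x) hx.1
  refine mem_inf.mpr ⟨?_, (φ x).2⟩
  have h2 : ((e.symm.trans φ).trans e) (e x) = e (φ x) := by simp
  rw [h2] at h1
  exact h1

/-- Conjugacy of the Sylow `p`-subgroups of a subgroup `X`. -/
theorem IsPGroup.exists_conj_mem_iff {p : ℕ} [Fact p.Prime] [Finite G] {D E X : Subgroup G}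
    (hD : IsPGroup p D) (hDX : D ≤ X) (hDi : ¬ p ∣ D.relIndex X)
    (hE : IsPGroup p E) (hEX : E ≤ X) (hEi : ¬ p ∣ E.relIndex X) :
    ∃ x ∈ X, ∀ y, y ∈ E ↔ x⁻¹ * y * x ∈ D := by
  have hD' : IsPGroup p (D.subgroupOf X) := hD.comap_subtype
  have hE' : IsPGroup p (E.subgroupOf X) := hE.comap_subtype
  obtain ⟨x, hx⟩ := MulAction.exists_smul_eq X (hD'.toSylow hDi) (hE'.toSylow hEi)
  have key : ∀ y : X, (y : G) ∈ E ↔ (x⁻¹ * y * x : G) ∈ D := by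
    intro y
    have : y ∈ hE'.toSylow hEi ↔ x⁻¹ * y * x ∈ hD'.toSylow hDi := by
      rw [← hx, Sylow.mem_smul_iff]
    exact this
  refine ⟨x, x.2, fun y => ⟨fun hy => (key ⟨y, hEX hy⟩).mp hy, fun hy => ?_⟩⟩
  have hyX : y ∈ X := by
    have := mul_mem (mul_mem x.2 (hDX hy)) (inv_mem x.2)
    simpa [mul_assoc] using this
  exact (key ⟨y, hyX⟩).mpr hy

/-- A form of the **Frattini argument**. -/
theorem IsPGroup.exists_inv_mul_mem_normalizer {p : ℕ} [Fact p.Prime] [Finite G]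
    {D X : Subgroup G} (hD : IsPGroup p D) (hDX : D ≤ X) (hi : ¬ p ∣ D.relIndex X) {g : G}
    (hg : g ∈ normalizer (X : Set G)) : ∃ x ∈ X, x⁻¹ * g ∈ normalizer (D : Set G) := by
  set f : G →* G := (MulAut.conj g).toMonoidHom
  have hf : Function.Injective f := (MulAut.conj g).injective
  have hX : X.map f = X := by
    ext y
    rw [mem_map_equiv]
    have := (mem_normalizer_iff.mp (inv_mem hg)) y
    simpa using this.symm
  have hmem : ∀ y, y ∈ D.map f ↔ g⁻¹ * y * g ∈ D := fun y => by
    rw [mem_map_equiv]; simp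
  obtain ⟨x, hx, hxD⟩ := hD.exists_conj_mem_iff hDX hi (hD.map f)
    ((Subgroup.map_mono hDX).trans hX.le) (by
      rw [← hX, relIndex_map_map_of_injective _ _ hf]; exact hi)
  refine ⟨x, hx, mem_normalizer_iff.mpr fun y => ?_⟩
  have := (hxD (g * y * g⁻¹)).symm.trans (hmem (g * y * g⁻¹))
  simp only [mul_assoc, inv_mul_cancel_left, inv_mul_cancel, mul_one] at this
  simp only [mul_assoc, mul_inv_rev, inv_inv]
  exact this.symm

end CharIn

section LocalComplements

open Subgroup

variable {p : ℕ} {G : Type*} [Group G]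

/-- The normalizers of the nontrivial characteristic subgroups of the Sylow `p`-subgroups of `G`
have normal `p`-complements. -/
def HasLocalNormalPComplements (p : ℕ) (G : Type*) [Group G] : Prop :=
  ∀ P : Sylow p G, ∀ D : Subgroup G, IsCharIn D P → D ≠ ⊥ →
    HasNormalPComplement p (normalizer (D : Set G))

namespace HasLocalNormalPComplements

variable [Fact p.Prime]

theorem normalizer (h : HasLocalNormalPComplements p G) {P D : Subgroup G} (hP : IsPGroup p P)
    (hi : ¬ p ∣ P.index) (hD : IsCharIn D P) (hD1 : D ≠ ⊥) :
    HasNormalPComplement p (normalizer (D : Set G)) :=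
  h (hP.toSylow hi) D hD hD1

variable [Finite G]

theorem subgroup (h : HasLocalNormalPComplements p G) {H : Subgroup G} (hi : ¬ p ∣ H.index) :
    HasLocalNormalPComplements p H := by
  intro S D hD hD1
  refine HasNormalPComplement.normalizer_of_map H.subtype_injective ?_
  refine h.normalizer (S.2.map H.subtype) ?_ (hD.map H.subtype_injective.injOn) ?_
  · rw [index_map_subtype]
    exact (Fact.out : p.Prime).not_dvd_mul S.not_dvd_index hi
  · rwa [Ne, map_eq_bot_iff_of_injective _ H.subtype_injective]

theorem exists_normal (h : HasLocalNormalPComplements p G) (hn : ¬ HasNormalPComplement p G)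
    (ih : ∀ H : Subgroup G, H ≠ ⊤ → HasLocalNormalPComplements p H → HasNormalPComplement p H) :
    ∃ U : Subgroup G, U.Normal ∧ IsPGroup p U ∧ U ≠ ⊥ ∧ ∀ C : Subgroup G, IsPGroup p C → U < C →
      ¬ p ∣ (Subgroup.normalizer (C : Set G)).index →
      HasNormalPComplement p (Subgroup.normalizer (C : Set G)) := by
  set μ : Subgroup G → ℕ := fun X => (Nat.card X).factorization p with hμ
  set T : Set (Subgroup G) := {U | IsPGroup p U ∧ U ≠ ⊥ ∧
    ¬ HasNormalPComplement p (Subgroup.normalizer (U : Set G))} with hT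
  have hTne : T.Nonempty := by
    by_contra hne
    refine hn (HasNormalPComplement.of_normalizer fun U hU hU1 => ?_)
    by_contra hc
    exact hne ⟨U, hU, hU1, hc⟩
  obtain ⟨U, ⟨hU, hU1, hUn⟩, hmax⟩ := Set.exists_max_image T
    (fun U => toLex (μ (Subgroup.normalizer (U : Set G)), Nat.card U)) (Set.toFinite T) hTne
  have hPN : ∀ C : Subgroup G, IsPGroup p C → C ≠ ⊥ →
      (μ (Subgroup.normalizer (U : Set G)) < μ (Subgroup.normalizer (C : Set G)) ∨
        μ (Subgroup.normalizer (U : Set G)) = μ (Subgroup.normalizer (C : Set G)) ∧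
          Nat.card U < Nat.card C) → HasNormalPComplement p (Subgroup.normalizer (C : Set G)) := by
    intro C hC hC1 hlt
    by_contra hc
    exact (hmax C ⟨hC, hC1, hc⟩).not_gt (Prod.Lex.toLex_lt_toLex.mpr hlt)
  have hloc : HasLocalNormalPComplements p (Subgroup.normalizer (U : Set G)) := by
    set N := Subgroup.normalizer (U : Set G)
    intro S D hD hD1
    have hD' := hD.map N.subtype_injective.injOn
    have hD1' : D.map N.subtype ≠ ⊥ := by
      rwa [Ne, map_eq_bot_iff_of_injective _ N.subtype_injective]
    have hS' : IsPGroup p ((S : Subgroup N).map N.subtype) := S.2.map N.subtype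
    refine HasNormalPComplement.normalizer_of_map N.subtype_injective ?_
    by_cases hi : p ∣ ((S : Subgroup N).map N.subtype).index
    · obtain ⟨R, hR⟩ := hS'.exists_le_sylow
      have hlt : (S : Subgroup N).map N.subtype < R := by
        refine lt_of_le_of_ne hR fun he => ?_
        rw [he] at hi
        exact R.not_dvd_index hi
      have h1 := R.2.exists_mem_normalizer_of_lt hlt
      refine hPN _ (hS'.to_le hD'.1) hD1' (Or.inl ?_)
      set X := (R : Subgroup G) ⊓ Subgroup.normalizer ((S : Subgroup N).map N.subtype : Set G)
      obtain ⟨k, hk⟩ := IsPGroup.iff_card.mp (R.2.to_le (inf_le_left : X ≤ R))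
      have h2 : Nat.card ((S : Subgroup N).map N.subtype) < Nat.card X :=
        Set.Finite.card_lt_card (Set.toFinite _) h1
      rw [Subgroup.card_map_eq N.subtype_injective, S.card_eq_multiplicity, hk,
        Nat.pow_lt_pow_iff_right (Fact.out : p.Prime).one_lt] at h2
      refine h2.trans_le ?_
      rw [hμ, ← (Fact.out : p.Prime).pow_dvd_iff_le_factorization Nat.card_pos.ne', ← hk]
      exact card_dvd_of_le (inf_le_right.trans hD'.normalizer_le)
    · exact h.normalizer hS' hi hD' hD1'
  have htop : Subgroup.normalizer (U : Set G) = ⊤ := by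
    by_contra hne
    exact hUn (ih _ hne hloc)
  refine ⟨U, normalizer_eq_top_iff.mp htop, hU, hU1,
    fun C hC hUC hi => hPN C hC ?_ (Or.inr ⟨?_, ?_⟩)⟩
  · rintro rfl
    exact not_lt_bot hUC
  · rw [htop]
    have := card_mul_index (Subgroup.normalizer (C : Set G))
    simp only [hμ]
    rw [card_top, ← this, Nat.factorization_mul Nat.card_pos.ne' index_ne_zero_of_finite,
      Finsupp.add_apply, Nat.factorization_eq_zero_of_not_dvd hi, add_zero]
  · exact Set.Finite.card_lt_card (Set.toFinite _) hUC

end HasLocalNormalPComplements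

end LocalComplements

section LocalComplements

open Subgroup

variable {p : ℕ} [Fact p.Prime] {G : Type*} [Group G]

namespace HasLocalNormalPComplements

theorem le_of_isPGroup_of_normal (hn : ¬ HasNormalPComplement p G) {U : Subgroup G} [U.Normal]
    (hU : IsPGroup p U)
    (hC : ∀ C : Subgroup G, IsPGroup p C → U < C →
      ¬ p ∣ (Subgroup.normalizer (C : Set G)).index →
      HasNormalPComplement p (Subgroup.normalizer (C : Set G)))
    {W : Subgroup G} [W.Normal] (hW : IsPGroup p W) : W ≤ U := by
  by_contra hle
  have hlt : U < U ⊔ W := by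
    refine lt_of_le_of_ne le_sup_left fun he => hle ?_
    rw [he]
    exact le_sup_right
  have htop : Subgroup.normalizer ((U ⊔ W : Subgroup G) : Set G) = ⊤ :=
    normalizer_eq_top_iff.mpr inferInstance
  have := hC (U ⊔ W) (hU.to_sup_of_normal_right hW) hlt
  rw [htop, index_top] at this
  exact hn (this (Fact.out : p.Prime).not_dvd_one).of_top

variable [Finite G]

theorem quotient_isPGroup {U : Subgroup G} [U.Normal] (hU : IsPGroup p U)
    (hC : ∀ C : Subgroup G, IsPGroup p C → U < C →
      ¬ p ∣ (Subgroup.normalizer (C : Set G)).index →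
      HasNormalPComplement p (Subgroup.normalizer (C : Set G))) :
    HasLocalNormalPComplements p (G ⧸ U) := by
  intro P D hD hD1
  have hs := QuotientGroup.mk'_surjective U
  have hker : (QuotientGroup.mk' U).ker = U := QuotientGroup.ker_mk' U
  have hpg : IsPGroup p (D.comap (QuotientGroup.mk' U)) :=
    (P.2.to_le hD.1).comap_of_ker_isPGroup _ (by rwa [hker])
  have hlt : U < D.comap (QuotientGroup.mk' U) := by
    refine lt_of_le_of_ne (hker.ge.trans (ker_le_comap _ _)) fun he => hD1 ?_
    rw [← map_comap_eq_self_of_surjective hs D, ← he, Subgroup.map_eq_bot_iff, hker]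
  have hN : Subgroup.normalizer (D.comap (QuotientGroup.mk' U) : Set G) =
      (Subgroup.normalizer (D : Set (G ⧸ U))).comap (QuotientGroup.mk' U) :=
    (comap_normalizer_eq_of_surjective D hs).symm
  have h1 := hC _ hpg hlt
  rw [hN, index_comap_of_surjective _ hs] at h1
  exact (h1 fun hp => P.not_dvd_index
    (hp.trans (index_dvd_of_le (le_normalizer.trans hD.normalizer_le)))).of_surjective
    ((QuotientGroup.mk' U).subgroupComap _)
    ((QuotientGroup.mk' U).subgroupComap_surjective_of_surjective _ hs)

theorem quotient_of_not_dvd_card (h : HasLocalNormalPComplements p G) {L : Subgroup G} [L.Normal]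
    (hL : ¬ p ∣ Nat.card L) : HasLocalNormalPComplements p (G ⧸ L) := by
  intro P' D' hD' hD1'
  have hs := QuotientGroup.mk'_surjective L
  obtain ⟨P, rfl⟩ := Sylow.mapSurjective_surjective hs p P'
  rw [Sylow.coe_mapSurjective] at hD'
  set f := QuotientGroup.mk' L with hf
  have hker : f.ker = L := QuotientGroup.ker_mk' L
  have hdisj : (P : Subgroup G) ⊓ L = ⊥ := by
    obtain ⟨n, hn⟩ := IsPGroup.iff_card.mp P.2
    refine (disjoint_of_coprime_natCard ?_).eq_bot
    rw [hn]
    exact ((Fact.out : p.Prime).coprime_iff_not_dvd.mpr hL).pow_left n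
  have hinj : Set.InjOn f P := by
    intro x hx y hy hxy
    have h1 : x⁻¹ * y ∈ (P : Subgroup G) ⊓ L :=
      mem_inf.mpr ⟨mul_mem (inv_mem hx) hy, QuotientGroup.eq.mp hxy⟩
    rw [hdisj, mem_bot] at h1
    exact inv_mul_eq_one.mp h1
  set D := D'.comap f ⊓ P with hDdef
  have hmap : D.map f = D' := by
    refine le_antisymm (map_le_iff_le_comap.mpr inf_le_left) fun y hy => ?_
    obtain ⟨x, hx, rfl⟩ := hD'.1 hy
    exact mem_map_of_mem f (mem_inf.mpr ⟨hy, hx⟩)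
  have hD1 : D ≠ ⊥ := by
    intro he
    rw [he, Subgroup.map_bot] at hmap
    exact hD1' hmap.symm
  have hDP : IsPGroup p D := P.2.to_le inf_le_right
  have hcard : Nat.card D = Nat.card D' := by
    rw [← hmap]
    exact (Nat.card_image_of_injOn (hinj.mono (inf_le_right : D ≤ P))).symm
  have hDX : D ≤ D'.comap f := inf_le_left
  have hi : ¬ p ∣ D.relIndex (D'.comap f) := by
    have h1 := card_mul_relIndex_of_le hDX
    have h2 : Nat.card (D'.comap f) = Nat.card L * Nat.card D' :=
      QuotientGroup.card_preimage_mk L (D' : Set (G ⧸ L))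
    rw [h2, hcard, mul_comm] at h1
    rwa [Nat.eq_of_mul_eq_mul_right Nat.card_pos h1]
  have hle : ∀ n ∈ Subgroup.normalizer (D : Set G),
      f n ∈ Subgroup.normalizer (D' : Set (G ⧸ L)) := by
    intro n hn
    rw [← hmap]
    exact le_normalizer_map f (mem_map_of_mem f hn)
  refine (h P D (hD'.comap_inf hinj) hD1).of_surjective
    ((f.comp (Subgroup.normalizer (D : Set G)).subtype).codRestrict _ fun n => hle n n.2) ?_
  rintro ⟨y, hy⟩
  obtain ⟨g, rfl⟩ := hs y
  have hg : g ∈ Subgroup.normalizer (D'.comap f : Set G) := by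
    rw [← comap_normalizer_eq_of_surjective D' hs]
    exact hy
  obtain ⟨x, hx, hxg⟩ := hDP.exists_inv_mul_mem_normalizer hDX hi hg
  have hx' : f x ∈ D.map f := by rw [hmap]; exact hx
  obtain ⟨d, hd, hdx⟩ := hx'
  refine ⟨⟨d * (x⁻¹ * g), mul_mem (le_normalizer hd) hxg⟩, Subtype.ext ?_⟩
  change f (d * (x⁻¹ * g)) = f g
  rw [map_mul, hdx, ← map_mul, mul_inv_cancel_left]

end HasLocalNormalPComplements

end LocalComplements

section LocalComplements

open Subgroup

variable {p : ℕ} [Fact p.Prime] {G : Type*} [Group G] [Finite G]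

/-- A consequence of **Burnside's transfer theorem**. -/
theorem HasNormalPComplement.of_le_center (P : Sylow p G)
    (hP : (P : Subgroup G) ≤ center G) : HasNormalPComplement p G := by
  have hN : normalizer (P : Set G) ≤ centralizer (P : Set G) := by
    intro g _ x hx
    exact (mem_center_iff.mp (hP hx) g).symm
  refine ⟨_, inferInstance, MonoidHom.not_dvd_card_ker_transferSylow P hN, ?_⟩
  obtain ⟨n, hn⟩ := IsPGroup.iff_card.mp P.2
  refine ⟨n, ?_⟩
  rw [← hn, (MonoidHom.ker_transferSylow_isComplement' P hN).symm.index_eq_card]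

theorem centralizer_le_of_quotient {U : Subgroup G} [U.Normal]
    (hPN : HasNormalPComplement p (G ⧸ U))
    (hW : ∀ W : Subgroup G, W.Normal → IsPGroup p W → W ≤ U)
    (hL : ∀ L : Subgroup G, L.Normal → ¬ p ∣ Nat.card L → L = ⊥) :
    centralizer (U : Set G) ≤ U := by
  obtain ⟨N, hN, hmem, hcard, -⟩ := hPN.exists_mem_iff
  set f := QuotientGroup.mk' U
  set X : Subgroup G := centralizer (U : Set G) ⊓ N.comap f with hX
  have hXn : X.Normal := inferInstance
  have hXU : ∀ x ∈ X, ∀ n, x ^ p ^ n = 1 → x ∈ U := by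
    intro x hx n hn
    have h1 : ¬ p ∣ orderOf (f x) := (hmem _).mp hx.2
    have h2 : orderOf (f x) ∣ p ^ n := orderOf_dvd_of_pow_eq_one (by rw [← map_pow, hn, map_one])
    have h3 : orderOf (f x) = 1 :=
      Nat.Coprime.eq_one_of_dvd
        (((Fact.out : p.Prime).coprime_iff_not_dvd.mpr h1).symm.pow_right n) h2
    exact (QuotientGroup.eq_one_iff x).mp (orderOf_eq_one_iff.mp h3)
  obtain ⟨P⟩ : Nonempty (Sylow p X) := inferInstance
  have hPc : (P : Subgroup X) ≤ center X := by
    intro x hx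
    obtain ⟨n, hn⟩ := P.2 ⟨x, hx⟩
    have hxU : (x : G) ∈ U := hXU x x.2 n (congrArg (fun y : P => ((y : X) : G)) hn)
    rw [mem_center_iff]
    intro y
    exact Subtype.ext (y.2.1 _ hxU).symm
  obtain ⟨M, hM, -, hMmem, hMc, -⟩ := (HasNormalPComplement.of_le_center P hPc).exists_normal
  have hM1 := hL M hM hMc
  refine hW _ inferInstance fun ⟨x, hx⟩ => ?_
  obtain ⟨k, m, hm, hkm⟩ := Nat.exists_eq_pow_mul_and_not_dvd (orderOf_pos x).ne' p
    (Fact.out : p.Prime).ne_one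
  refine ⟨k, Subtype.ext ?_⟩
  have ho : orderOf (x ^ p ^ k) = m := by
    rw [orderOf_pow_of_dvd (pow_ne_zero _ (Fact.out : p.Prime).ne_zero)
        (by rw [hkm]; exact dvd_mul_right _ _),
      hkm, Nat.mul_div_cancel_left _ (pow_pos (Fact.out : p.Prime).pos k)]
  have h1 : x ^ p ^ k ∈ X := by
    refine mem_inf.mpr ⟨pow_mem hx _, (hmem _).mpr fun hp => hm ?_⟩
    rw [← ho]
    exact hp.trans (orderOf_map_dvd f _)
  have h2 := (hMmem _ h1).mpr (by rwa [ho])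
  rwa [hM1, mem_bot] at h2

theorem HasNormalPComplement.isPGroup_of_le {U H : Subgroup G} [U.Normal] (hU : IsPGroup p U)
    (hCU : centralizer (U : Set G) ≤ U) (hUH : U ≤ H) (hH : HasNormalPComplement p H) :
    IsPGroup p H := by
  obtain ⟨N, hN, hc, n, hn⟩ := hH
  have hd : Disjoint N (U.subgroupOf H) := by
    have hUp : IsPGroup p (U.subgroupOf H) := hU.comap_subtype
    obtain ⟨k, hk⟩ := IsPGroup.iff_card.mp hUp
    refine disjoint_of_coprime_natCard ?_
    rw [hk]
    exact (((Fact.out : p.Prime).coprime_iff_not_dvd.mpr hc).pow_left k).symm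
  have hNU : N ≤ U.subgroupOf H := by
    intro x hx
    refine hCU fun u hu => ?_
    exact congrArg Subtype.val
      (commute_of_normal_of_disjoint _ _ hN inferInstance hd x ⟨u, hUH hu⟩ hx hu).symm
  have hN1 : N = ⊥ := by rwa [← inf_eq_left.mpr hNU, ← disjoint_iff]
  rw [hN1, index_bot] at hn
  obtain ⟨k, -, hk⟩ := (Nat.dvd_prime_pow (Fact.out : p.Prime)).mp hn
  exact IsPGroup.of_card hk

theorem index_dvd_card_of_sup_eq_top {N K : Subgroup G} [K.Normal] (h : N ⊔ K = ⊤) :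
    N.index ∣ Nat.card K := by
  have h1 : K.index = K.relIndex N := by rw [← relIndex_top_right, ← h, relIndex_sup_right]
  have h2 := card_mul_relIndex_of_le (inf_le_right : K ⊓ N ≤ N)
  rw [inf_relIndex_right, ← h1] at h2
  have h3 : Nat.card N * N.index = Nat.card K * K.index := by
    rw [card_mul_index, card_mul_index]
  refine ⟨Nat.card (K ⊓ N : Subgroup G), ?_⟩
  refine Nat.eq_of_mul_eq_mul_right (Nat.pos_of_ne_zero (index_ne_zero_of_finite (H := K))) ?_
  rw [← h3, ← h2]
  ring

end LocalComplements

section LocalComplements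

open Subgroup

universe u

variable {p : ℕ} [Fact p.Prime]

namespace HasLocalNormalPComplements

theorem false_of_normal {G : Type u} [Group G] [Finite G] (hodd : Odd p)
    (h : HasLocalNormalPComplements p G) (hn : ¬ HasNormalPComplement p G)
    (ih : ∀ (K : Type u) [Group K] [Finite K], Nat.card K < Nat.card G →
      HasLocalNormalPComplements p K → HasNormalPComplement p K)
    {U : Subgroup G} [U.Normal] (hU : IsPGroup p U) (hU1 : U ≠ ⊥)
    (hC : ∀ C : Subgroup G, IsPGroup p C → U < C →
      ¬ p ∣ (Subgroup.normalizer (C : Set G)).index →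
      HasNormalPComplement p (Subgroup.normalizer (C : Set G))) : False := by
  have hlt : ∀ L : Subgroup G, L ≠ ⊥ → Nat.card (G ⧸ L) < Nat.card G := by
    intro L hL
    rw [card_eq_card_quotient_mul_card_subgroup L]
    exact lt_mul_of_one_lt_right Nat.card_pos ((one_lt_card_iff_ne_bot L).mpr hL)
  have hW : ∀ W : Subgroup G, W.Normal → IsPGroup p W → W ≤ U := fun W _ hWp =>
    le_of_isPGroup_of_normal hn hU hC hWp
  have hL : ∀ L : Subgroup G, L.Normal → ¬ p ∣ Nat.card L → L = ⊥ := by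
    intro L _ hLp
    by_contra hL1
    exact hn (HasNormalPComplement.of_quotient hLp
      (ih _ (hlt L hL1) (h.quotient_of_not_dvd_card hLp)))
  have hPN : HasNormalPComplement p (G ⧸ U) := ih _ (hlt U hU1) (quotient_isPGroup hU hC)
  have hCU := centralizer_le_of_quotient hPN hW hL
  have hGp : ¬ IsPGroup p G := fun hp => hn (HasNormalPComplement.of_isPGroup hp)
  have hs := QuotientGroup.mk'_surjective U
  set f := QuotientGroup.mk' U with hf
  have hker : f.ker = U := QuotientGroup.ker_mk' U
  have hkerp : IsPGroup p f.ker := by rwa [hker]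
  obtain ⟨N, hN, -, hNp, n, hNn⟩ := hPN.exists_mem_iff
  have hN1 : Nat.card N ≠ 1 := by
    intro h1
    rw [card_eq_one] at h1
    rw [h1, index_bot] at hNn
    obtain ⟨k, -, hk⟩ := (Nat.dvd_prime_pow (Fact.out : p.Prime)).mp hNn
    have htop : IsPGroup p (⊤ : Subgroup (G ⧸ U)) := IsPGroup.of_card (by rw [card_top, hk])
    have := htop.comap_of_ker_isPGroup f hkerp
    rw [comap_top] at this
    exact hGp (this.of_equiv topEquiv)
  set q := (Nat.card N).minFac with hq
  have hqp : Fact q.Prime := ⟨Nat.minFac_prime hN1⟩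
  obtain ⟨R⟩ : Nonempty (Sylow q N) := inferInstance
  set R' := (R : Subgroup N).map N.subtype with hR'
  have hRN : R' ≤ N := map_subtype_le _
  have hfr : Subgroup.normalizer (R' : Set (G ⧸ U)) ⊔ N = ⊤ := R.normalizer_sup_eq_top
  have hRi : ¬ p ∣ (Subgroup.normalizer (R' : Set (G ⧸ U))).index := fun hp =>
    hNp (hp.trans (index_dvd_card_of_sup_eq_top hfr))
  obtain ⟨S⟩ : Nonempty (Sylow p (Subgroup.normalizer (R' : Set (G ⧸ U)))) := inferInstance
  set P' := (S : Subgroup _).map (Subgroup.normalizer (R' : Set (G ⧸ U))).subtype with hP'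
  have hP'p : IsPGroup p P' := S.2.map _
  have hP'i : ¬ p ∣ P'.index := by
    rw [hP', index_map_subtype]
    exact (Fact.out : p.Prime).not_dvd_mul S.not_dvd_index hRi
  set E' := ((center (R : Subgroup N)).map (R : Subgroup N).subtype).map N.subtype with hE'
  have hEchar : IsCharIn E' R' :=
    (IsCharIn.map_subtype (center (R : Subgroup N))).map N.subtype_injective.injOn
  have hE'p : ¬ p ∣ Nat.card E' := fun hp =>
    hNp (hp.trans (card_dvd_of_le (hEchar.1.trans hRN)))
  have hE'1 : E' ≠ ⊥ := by
    rw [hE', Ne, map_eq_bot_iff_of_injective _ N.subtype_injective,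
      map_eq_bot_iff_of_injective _ (R : Subgroup N).subtype_injective]
    have : Nontrivial R := (nontrivial_iff_ne_bot _).mpr
      (R.ne_bot_of_dvd_card (Nat.minFac_dvd _))
    have := R.2.center_nontrivial
    exact (nontrivial_iff_ne_bot _).mp this
  have hE'c : ∀ x ∈ E', ∀ y ∈ E', x * y = y * x := by
    rintro _ ⟨_, ⟨x, hx, rfl⟩, rfl⟩ _ ⟨_, ⟨y, hy, rfl⟩, rfl⟩
    exact congrArg (fun z : (R : Subgroup N) => ((z : N) : G ⧸ U)) (mem_center_iff.mp hy x)
  have hsup : P' ⊔ E' = ⊤ := by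
    by_contra hT
    set H := (P' ⊔ E').comap f
    have hHi : ¬ p ∣ H.index := by
      rw [index_comap_of_surjective _ hs]
      exact fun hp => hP'i (hp.trans (index_dvd_of_le le_sup_left))
    have hHtop : H ≠ ⊤ := fun he => hT <| by
      rw [← map_comap_eq_self_of_surjective hs (P' ⊔ E')]
      change H.map f = ⊤
      rw [he, map_top_of_surjective _ hs]
    have hHlt : Nat.card H < Nat.card G := lt_of_le_of_ne (card_le_card_group H)
      fun he => hHtop (eq_top_of_card_eq H he)
    have hHp : IsPGroup p H := HasNormalPComplement.isPGroup_of_le hU hCU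
      (hker.ge.trans (ker_le_comap _ _)) (ih H hHlt (h.subgroup hHi))
    have hEp : IsPGroup p E' := by
      have := hHp.map f
      rw [map_comap_eq_self_of_surjective hs] at this
      exact this.to_le le_sup_right
    obtain ⟨k, hk⟩ := IsPGroup.iff_card.mp hEp
    refine hE'1 ((card_eq_one).mp ?_)
    rcases Nat.eq_zero_or_pos k with rfl | hk0
    · simpa using hk
    · exact absurd (hk ▸ dvd_pow_self p hk0.ne') hE'p
  have hE'n : E'.Normal := by
    rw [← normalizer_eq_top_iff, eq_top_iff, ← hsup]
    exact sup_le ((map_subtype_le _).trans hEchar.normalizer_le) le_normalizer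
  have hPi : ¬ p ∣ (P'.comap f).index := by rwa [index_comap_of_surjective _ hs]
  set P : Sylow p G := (hP'p.comap_of_ker_isPGroup f hkerp).toSylow hPi with hP
  have hPcoe : (P : Subgroup G) = P'.comap f := rfl
  have hUP : U ≤ P := hker.ge.trans (ker_le_comap _ _)
  refine false_of_configuration hodd P (U := U) (E := E'.comap f) hW hU hCU ?_ hGp ?_ ?_ ?_
  · intro C hCc hC1
    have hCP := IsCharIn.map_subtype (P := (P : Subgroup G)) C
    refine HasNormalPComplement.isPGroup_of_le hU hCU
      (hUP.trans (le_normalizer.trans hCP.normalizer_le)) (h P _ hCP ?_)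
    rwa [Ne, map_eq_bot_iff_of_injective _ (P : Subgroup G).subtype_injective]
  · intro x hx y hy
    refine hker.le (MonoidHom.mem_ker.mpr ?_)
    rw [map_commutatorElement, commutatorElement_eq_one_iff_mul_comm]
    exact hE'c _ hx _ hy
  · intro x hx
    refine ⟨Nat.card E', hE'p, ?_⟩
    refine hker.le (MonoidHom.mem_ker.mpr ?_)
    rw [map_pow]
    exact orderOf_dvd_iff_pow_eq_one.mp (orderOf_dvd_natCard E' hx)
  · rw [hPcoe, comap_sup_eq _ _ _ hs, hsup, comap_top]

/-- If `p` is odd, a finite group has a normal `p`-complement as soon as the normalizers of the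
nontrivial characteristic subgroups of its Sylow `p`-subgroups do. -/
theorem hasNormalPComplement (hodd : Odd p) {G : Type u} [Group G] [Finite G]
    (h : HasLocalNormalPComplements p G) : HasNormalPComplement p G := by
  induction hc : Nat.card G using Nat.strong_induction_on generalizing G with
  | _ n ih =>
    subst hc
    by_contra hn
    have ih' : ∀ (K : Type u) [Group K] [Finite K], Nat.card K < Nat.card G →
        HasLocalNormalPComplements p K → HasNormalPComplement p K :=
      fun K _ _ hK hloc => ih _ hK hloc rfl
    obtain ⟨U, hUn, hU, hU1, hC⟩ := h.exists_normal hn fun H hH hloc =>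
      ih' H (lt_of_le_of_ne (card_le_card_group H) fun he => hH (eq_top_of_card_eq H he)) hloc
    exact false_of_normal hodd h hn ih' hU hU1 hC

end HasLocalNormalPComplements

end LocalComplements

section NilpotentMaximal

open Subgroup

theorem HasNormalPComplement.of_isNilpotent {p : ℕ} [Fact p.Prime] {G : Type*} [Group G] [Finite G]
    [Group.IsNilpotent G] : HasNormalPComplement p G := by
  suffices h : Finite G → HasNormalPComplement p G from h inferInstance
  refine Group.nilpotent_center_quotient_ind
    (P := fun G _ _ => Finite G → HasNormalPComplement p G) G ?_ ?_
  · intro G _ _ _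
    refine of_not_dvd_card ?_
    rw [Nat.card_unique]
    exact (Fact.out : p.Prime).not_dvd_one
  · intro G _ _ ih _
    obtain ⟨N, hN, hc, n, hn⟩ := ih inferInstance
    set f := QuotientGroup.mk' (center G)
    have hX : HasNormalPComplement p (N.comap f) := by
      obtain ⟨P⟩ : Nonempty (Sylow p (N.comap f)) := inferInstance
      refine of_le_center P fun x hx => ?_
      obtain ⟨k, hk⟩ := P.2 ⟨x, hx⟩
      have hk' : (x : G) ^ p ^ k = 1 := congrArg (fun y : P => ((y : N.comap f) : G)) hk
      have h1 : orderOf (f x) ∣ Nat.card N := orderOf_dvd_natCard N x.2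
      have h2 : orderOf (f x) ∣ p ^ k :=
        orderOf_dvd_of_pow_eq_one (by rw [← map_pow, hk', map_one])
      have h3 : orderOf (f x) = 1 := Nat.Coprime.eq_one_of_dvd
        ((((Fact.out : p.Prime).coprime_iff_not_dvd.mpr hc).pow_left k).symm.coprime_dvd_left h1) h2
      have hx' : (x : G) ∈ center G := (QuotientGroup.eq_one_iff _).mp (orderOf_eq_one_iff.mp h3)
      rw [mem_center_iff]
      intro y
      exact Subtype.ext (mem_center_iff.mp hx' y)
    refine of_normal_of_index hX (n := n) ?_
    rwa [index_comap_of_surjective _ (QuotientGroup.mk'_surjective _)]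

variable {G : Type*} [Group G] {M : Subgroup G}

theorem normalizer_eq_of_isCoatom (hmax : IsCoatom M) (hcore : M.normalCore = ⊥) {C : Subgroup G}
    (hCM : C ≤ M) (hC : C ≠ ⊥) (h : M ≤ normalizer (C : Set G)) :
    normalizer (C : Set G) = M := by
  rcases hmax.le_iff.mp h with h | h
  · have : C.Normal := normalizer_eq_top_iff.mp h
    refine absurd ?_ hC
    rw [eq_bot_iff, ← hcore]
    exact normal_le_normalCore.mpr hCM
  · exact h

variable [Finite G]

theorem exists_sylow_normalizer_eq (hmax : IsCoatom M) (hcore : M.normalCore = ⊥)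
    (hnil : Group.IsNilpotent M) {p : ℕ} [Fact p.Prime] (hp : p ∣ Nat.card M) :
    ∃ P : Sylow p G, normalizer (P : Set G) = M := by
  obtain ⟨S⟩ : Nonempty (Sylow p M) := inferInstance
  have htfae := (Group.isNilpotent_of_finite_tfae (G := M)).out 0 3
  have hSn : (S : Subgroup M).Normal := htfae.mp hnil p inferInstance S
  have hS1 : (S : Subgroup M).map M.subtype ≠ ⊥ := by
    rw [Ne, map_eq_bot_iff_of_injective _ M.subtype_injective]
    exact S.ne_bot_of_dvd_card hp
  have hle : M ≤ normalizer ((S : Subgroup M).map M.subtype : Set G) := by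
    have h1 := le_normalizer_map (H := (S : Subgroup M)) M.subtype
    rw [normalizer_eq_top_iff.mpr hSn, ← MonoidHom.range_eq_map, range_subtype] at h1
    exact h1
  have hN := normalizer_eq_of_isCoatom hmax hcore (map_subtype_le _) hS1 hle
  obtain ⟨R, hR⟩ := (S.2.map M.subtype).exists_le_sylow
  suffices he : (S : Subgroup M).map M.subtype = R by
    refine ⟨R, ?_⟩
    rw [he] at hN
    exact hN
  by_contra hne
  have hlt := R.2.exists_mem_normalizer_of_lt (lt_of_le_of_ne hR hne)
  rw [hN] at hlt
  have hQ : IsPGroup p (((R : Subgroup G) ⊓ M).subgroupOf M) :=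
    (R.2.to_le inf_le_left : IsPGroup p (R ⊓ M : Subgroup G)).comap_subtype
  have hSQ : (S : Subgroup M) ≤ ((R : Subgroup G) ⊓ M).subgroupOf M := fun x hx =>
    hlt.le (mem_map_of_mem M.subtype hx)
  have h3 := S.is_maximal' hQ hSQ
  rw [← h3, subgroupOf_map_subtype, inf_assoc, inf_idem] at hlt
  exact lt_irrefl _ hlt

theorem hasLocalNormalPComplements_of_isCoatom (hmax : IsCoatom M) (hcore : M.normalCore = ⊥)
    (hnil : Group.IsNilpotent M) {p : ℕ} [Fact p.Prime] (hp : p ∣ Nat.card M) :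
    HasLocalNormalPComplements p G := by
  obtain ⟨P, hP⟩ := exists_sylow_normalizer_eq hmax hcore hnil hp
  intro Q D hD hD1
  obtain ⟨g, hg⟩ := MulAction.exists_smul_eq G Q P
  set f : G →* G := (MulAut.conj g).toMonoidHom
  have hf : Function.Injective f := (MulAut.conj g).injective
  have hQ : (Q : Subgroup G).map f = P := by
    rw [← hg]
    rfl
  have hD' := hD.map hf.injOn
  rw [hQ] at hD'
  refine HasNormalPComplement.normalizer_of_map hf ?_
  have hN : normalizer (D.map f : Set G) = M := by
    refine normalizer_eq_of_isCoatom hmax hcore (hD'.1.trans (le_normalizer.trans hP.le)) ?_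
      (hP.ge.trans hD'.normalizer_le)
    rwa [Ne, map_eq_bot_iff_of_injective _ hf]
  rw [hN]
  exact HasNormalPComplement.of_isNilpotent

theorem exists_normal_mem_iff_coprime {n : ℕ}
    (h : ∀ p, p.Prime → p ∣ n → HasNormalPComplement p G) :
    ∃ K : Subgroup G, K.Normal ∧ ∀ x, x ∈ K ↔ (orderOf x).Coprime n := by
  have h' : ∀ p, p.Prime → p ∣ n → ∃ N : Subgroup G, N.Normal ∧ ∀ x, x ∈ N ↔ ¬ p ∣ orderOf x := by
    intro p hp hn
    have := Fact.mk hp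
    obtain ⟨N, hN, hmem, -⟩ := (h p hp hn).exists_mem_iff
    exact ⟨N, inferInstance, hmem⟩
  choose N hN hmem using h'
  refine ⟨⨅ p, ⨅ hp, ⨅ hn, N p hp hn, ?_, fun x => ?_⟩
  · exact normal_iInf_normal fun p => normal_iInf_normal fun hp => normal_iInf_normal (hN p hp)
  · simp only [mem_iInf, hmem]
    constructor
    · intro hx
      exact Nat.coprime_of_dvd fun p hp hpx hpn => hx p hp hpn hpx
    · intro hx p hp hpn hpx
      exact Nat.Prime.not_coprime_iff_dvd.mpr ⟨p, hp, hpx, hpn⟩ hx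

end NilpotentMaximal

section NilpotentMaximal

open Subgroup

variable {G : Type*} [Group G] {M : Subgroup G}

theorem isSolvable_of_isCoatom_bot (h : IsCoatom (⊥ : Subgroup G)) : Group.IsSolvable G := by
  refine Group.isSolvable_of_comm fun a b => ?_
  by_cases ha : a = 1
  · simp [ha]
  · have h1 : zpowers a = ⊤ := h.2 _ (bot_lt_iff_ne_bot.mpr (zpowers_ne_bot.mpr ha))
    have hb : b ∈ zpowers a := h1 ▸ mem_top b
    obtain ⟨n, rfl⟩ := mem_zpowers_iff.mp hb
    exact (Commute.refl a).zpow_right n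

variable [Finite G]

/-- If `K` is a normal subgroup with `K ⊓ normalizer P = ⊥` and `P` normalizes `Q`, where
`normalizer Q ⊔ K = ⊤`, then `normalizer P` normalizes `Q`. -/
theorem normalizer_sylow_le_normalizer {p : ℕ} [Fact p.Prime] (P : Sylow p G) {K Q : Subgroup G}
    [K.Normal] (hK : K ⊓ normalizer (P : Set G) = ⊥)
    (hPQ : (P : Subgroup G) ≤ normalizer (Q : Set G)) (hQ : normalizer (Q : Set G) ⊔ K = ⊤) :
    normalizer (P : Set G) ≤ normalizer (Q : Set G) := by
  intro m hm
  have hm' : m ∈ K ⊔ normalizer (Q : Set G) := by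
    rw [sup_comm, hQ]
    exact mem_top m
  obtain ⟨k, hk, x, hx, rfl⟩ := mem_sup_of_normal_left.mp hm'
  set f : G →* G := (MulAut.conj x).toMonoidHom
  have hmem : ∀ y, y ∈ (P : Subgroup G).map f ↔ x⁻¹ * y * x ∈ P := fun y => by
    rw [mem_map_equiv]; simp; rfl
  have hmP : ∀ y, y ∈ P ↔ x⁻¹ * (k⁻¹ * y * k) * x ∈ P := fun y => by
    have : y ∈ P ↔ (k * x)⁻¹ * y * (k * x)⁻¹⁻¹ ∈ P := mem_normalizer_iff.mp (inv_mem hm) y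
    simpa [mul_assoc] using this
  set H : Subgroup G := (K ⊔ P) ⊓ normalizer (Q : Set G)
  have hPH : (P : Subgroup G) ≤ H := le_inf le_sup_right hPQ
  have hPH' : (P : Subgroup G).map f ≤ H := by
    intro y hy
    have hy' := (hmem y).mp hy
    refine mem_inf.mpr ⟨?_, ?_⟩
    · have h1 : k * y * k⁻¹ ∈ P := (hmP _).mpr (by simpa [mul_assoc] using hy')
      have hk' : k ∈ K ⊔ P := mem_sup_left hk
      have h2 := mul_mem (mul_mem (inv_mem hk') (mem_sup_right h1)) hk'
      simpa [mul_assoc] using h2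
    · have h2 := mul_mem (mul_mem hx (hPQ hy')) (inv_mem hx)
      simpa [mul_assoc] using h2
  have hi : ¬ p ∣ (P : Subgroup G).relIndex H := fun hp =>
    P.not_dvd_index (hp.trans (Dvd.intro _ (relIndex_mul_index hPH)))
  have hi' : ¬ p ∣ ((P : Subgroup G).map f).relIndex H := fun hp =>
    (x • P).not_dvd_index (hp.trans (Dvd.intro _ (relIndex_mul_index hPH')))
  obtain ⟨h, hh, hhP⟩ := P.2.exists_conj_mem_iff hPH hi (P.2.map f) hPH' hi'
  obtain ⟨j, hj, s, hs, rfl⟩ := mem_sup_of_normal_left.mp hh.1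
  have hjQ : j ∈ normalizer (Q : Set G) := by
    have := mul_mem (mem_inf.mp hh).2 (inv_mem (hPQ hs))
    simpa [mul_assoc] using this
  have hkj : k * j ∈ K ⊓ normalizer (P : Set G) := by
    refine mem_inf.mpr ⟨mul_mem hk hj, mem_normalizer_iff.mpr fun y => ?_⟩
    have h1 := hmP (k * j * y * (k * j)⁻¹)
    have h2 := (hmem (j * y * j⁻¹)).symm.trans (hhP (j * y * j⁻¹))
    have hsP : s ∈ normalizer (P : Set G) := le_normalizer (H := (P : Subgroup G)) hs
    have h3 : y ∈ P ↔ s⁻¹ * y * s⁻¹⁻¹ ∈ P := mem_normalizer_iff.mp (inv_mem hsP) y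
    simp only [mul_assoc, mul_inv_rev, inv_mul_cancel_left, inv_inv, inv_mul_cancel, mul_one]
      at h1 h2 h3 ⊢
    exact h3.trans (h2.symm.trans h1.symm)
  rw [hK, mem_bot] at hkj
  rw [eq_inv_of_mul_eq_one_left hkj]
  exact mul_mem (inv_mem hjQ) hx

theorem isSolvable_of_normalCore_eq_bot (hmax : IsCoatom M) (hcore : M.normalCore = ⊥)
    (hnil : Group.IsNilpotent M) (hodd : Odd (Nat.card M)) : Group.IsSolvable G := by
  by_cases hM1 : Nat.card M = 1
  · rw [card_eq_one] at hM1
    exact isSolvable_of_isCoatom_bot (hM1 ▸ hmax)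
  obtain ⟨K, hK, hKmem⟩ := exists_normal_mem_iff_coprime (G := G) (n := Nat.card M)
    fun p hp hpM => by
      have := Fact.mk hp
      exact (hasLocalNormalPComplements_of_isCoatom hmax hcore hnil hpM).hasNormalPComplement
        (hodd.of_dvd_nat hpM)
  have hKM : K ⊓ M = ⊥ := by
    rw [eq_bot_iff]
    rintro x ⟨hx, hxM⟩
    exact orderOf_eq_one_iff.mp
      (Nat.Coprime.eq_one_of_dvd ((hKmem x).mp hx) (orderOf_dvd_natCard M hxM))
  have hpK : ∀ p, p.Prime → p ∣ Nat.card M → ¬ p ∣ Nat.card K := by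
    intro p hp hpM hpK
    have := Fact.mk hp
    obtain ⟨x, hx⟩ := exists_prime_orderOf_dvd_card' p hpK
    have h1 := (hKmem x).mp x.2
    rw [orderOf_coe, hx] at h1
    exact hp.coprime_iff_not_dvd.mp h1 hpM
  set q := M.index.minFac
  have hq : Fact q.Prime := ⟨Nat.minFac_prime (mt index_eq_one.mp hmax.1)⟩
  have hqi : q ∣ M.index := Nat.minFac_dvd _
  have hqM : ¬ q ∣ Nat.card M := by
    intro hqM
    obtain ⟨P, hP⟩ := exists_sylow_normalizer_eq hmax hcore hnil hqM
    exact P.not_dvd_index (hqi.trans (index_dvd_of_le (le_normalizer.trans hP.le)))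
  set p := (Nat.card M).minFac
  have hp : Fact p.Prime := ⟨Nat.minFac_prime hM1⟩
  have hpM : p ∣ Nat.card M := Nat.minFac_dvd _
  obtain ⟨P, hP⟩ := exists_sylow_normalizer_eq hmax hcore hnil hpM
  have hQK : ∀ Q : Sylow q G, (Q : Subgroup G) ≤ K := by
    intro Q x hx
    obtain ⟨n, hn⟩ := Q.2 ⟨x, hx⟩
    have hn' : x ^ q ^ n = 1 := congrArg Subtype.val hn
    exact (hKmem x).mpr (((hq.out.coprime_iff_not_dvd.mpr hqM).pow_left n).coprime_dvd_left
      (orderOf_dvd_of_pow_eq_one hn'))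
  have hfr : ∀ Q : Sylow q G, normalizer (Q : Set G) ⊔ K = ⊤ := fun Q =>
    Q.normalizer_sup_eq_top' (hQK Q)
  obtain ⟨Q, hPQ⟩ : ∃ Q : Sylow q G, (P : Subgroup G) ≤ normalizer (Q : Set G) := by
    obtain ⟨Q⟩ : Nonempty (Sylow q G) := inferInstance
    have hi : ¬ p ∣ (normalizer (Q : Set G)).index := fun h =>
      hpK p hp.out hpM (h.trans (index_dvd_card_of_sup_eq_top (hfr Q)))
    obtain ⟨S⟩ : Nonempty (Sylow p (normalizer (Q : Set G))) := inferInstance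
    have hSi : ¬ p ∣ ((S : Subgroup _).map (normalizer (Q : Set G)).subtype).index := by
      rw [index_map_subtype]
      exact hp.out.not_dvd_mul S.not_dvd_index hi
    obtain ⟨g, hg⟩ := MulAction.exists_smul_eq G ((S.2.map _).toSylow hSi) P
    refine ⟨g • Q, fun x hx => ?_⟩
    rw [← hg] at hx
    have h1 : g⁻¹ * x * g ∈ normalizer (Q : Set G) :=
      map_subtype_le _ (Sylow.mem_smul_iff.mp hx)
    rw [← Sylow.smul_eq_iff_mem_normalizer] at h1 ⊢
    have h2 : x • g • Q = g • (g⁻¹ * x * g) • Q := by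
      simp only [← mul_smul, mul_assoc, mul_inv_cancel_left]
    rw [h2, h1]
  have hMQ : M ≤ normalizer (Q : Set G) := by
    rw [← hP]
    exact normalizer_sylow_le_normalizer P (by rw [hP, hKM]) hPQ (hfr Q)
  have hQM : ¬ (Q : Subgroup G) ≤ M := fun hle =>
    hqM ((Q.dvd_card_of_dvd_card (hqi.trans (index_dvd_card M))).trans (card_dvd_of_le hle))
  have hQn : (Q : Subgroup G).Normal := by
    rcases hmax.le_iff.mp hMQ with h | h
    · exact normalizer_eq_top_iff.mp h
    · exact absurd (le_normalizer.trans h.le) hQM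
  have hsup : M ⊔ Q = ⊤ :=
    hmax.2 _ (left_lt_sup.mpr hQM)
  have hQs : Group.IsSolvable Q := by
    have : Group.IsNilpotent Q := Q.2.isNilpotent
    infer_instance
  have hQq : Group.IsSolvable (G ⧸ (Q : Subgroup G)) := by
    refine Group.isSolvable_of_surjective
      (f := (QuotientGroup.mk' (Q : Subgroup G)).comp M.subtype) ?_
    intro y
    obtain ⟨g, rfl⟩ := QuotientGroup.mk'_surjective _ y
    obtain ⟨m, hm, x, hx, rfl⟩ := mem_sup_of_normal_right.mp (hsup ▸ mem_top g : g ∈ M ⊔ Q)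
    refine ⟨⟨m, hm⟩, QuotientGroup.eq.mpr ?_⟩
    simpa using hx
  exact Group.isSolvable_of_ker_le_range (Q : Subgroup G).subtype
    (QuotientGroup.mk' (Q : Subgroup G))
    (by simp)

theorem isSolvable_of_isCoatom (hmax : IsCoatom M) (hnil : Group.IsNilpotent M)
    (hodd : Odd (Nat.card M)) : Group.IsSolvable G := by
  set L := M.normalCore
  set f := QuotientGroup.mk' L
  have hs : Function.Surjective f := QuotientGroup.mk'_surjective L
  have hker : f.ker = L := QuotientGroup.ker_mk' L
  have hLM : L ≤ M := normalCore_le M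
  have hcomap : (M.map f).comap f = M := comap_map_eq_self (hker.le.trans hLM)
  have hmax' : IsCoatom (M.map f) := by
    refine ⟨fun h => hmax.1 (by rw [← hcomap, h, comap_top]), fun X hX => ?_⟩
    refine comap_injective hs ?_
    rw [comap_top]
    exact hmax.2 _ (hcomap.ge.trans_lt ((comap_lt_comap_of_surjective hs).mpr hX))
  have hcore : (M.map f).normalCore = ⊥ := by
    have h1 : (M.map f).normalCore.comap f ≤ L :=
      normal_le_normalCore.mpr ((comap_mono (normalCore_le _)).trans hcomap.le)
    rw [← map_comap_eq_self_of_surjective hs (M.map f).normalCore, Subgroup.map_eq_bot_iff, hker]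
    exact h1
  have hnil' : Group.IsNilpotent (M.map f) :=
    Group.nilpotent_of_surjective (f.subgroupMap M) (f.subgroupMap_surjective M)
  have hL : Group.IsSolvable L :=
    Group.isSolvable_of_isSolvable_injective (f := inclusion hLM) (inclusion_injective hLM)
  have hGL : Group.IsSolvable (G ⧸ L) := isSolvable_of_normalCore_eq_bot hmax' hcore hnil'
    (hodd.of_dvd_nat (card_map_dvd M f))
  exact Group.isSolvable_of_ker_le_range L.subtype f (by simp [hker])

end NilpotentMaximal

theorem stmt_6 {G : Type*} [Group G] [Finite G] (M : Subgroup G)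
    (hmax : IsCoatom M) (hnil : Group.IsNilpotent M) (hodd : Odd (Nat.card M)) :
    IsSolvable G :=
  isSolvable_of_isCoatom hmax hnil hodd
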